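/- arXiv:1904.09534 — 7 statements merged into one kernel-verified Lean document; each statement's English description precedes it below -/
import Mathlib

section
/- Let f be the complex Gaussian density with parameters (μ, Γ, C), and define f_Q : ℂ → ℝ by f_Q(q) := (exp(−(1/2)·μ̲ᴴ Σ⁻¹ μ̲) / (π² · √((det Γ)·(det P)))) · ∫_{θ=0}^{π} ₁F₁(2; 1/2; B_μ(θ, q)²/A(θ, q)) · A(θ, q)⁻² dθ. Then the pushforward, under the almost-everywhere defined map (z₁, z₂) ↦ z₂/z₁, of the measure on ℂ² having density f with respect to Lebesgue measure equals the measure on ℂ having density f_Q with respect to Lebesgue measure. (Paper's Theorem 'Complex Gaussian quotient density'.) -/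
open MeasureTheory Matrix Complex Real
open scoped ComplexOrder

noncomputable section

/-- The augmented vector `w̲ = (w₁, w₂, conj w₁, conj w₂)` of `w ∈ ℂ²`. -/
def aug (w : Fin 2 → ℂ) : Fin 4 → ℂ :=
  ![w 0, w 1, (starRingEnd ℂ) (w 0), (starRingEnd ℂ) (w 1)]

/-- The augmented covariance matrix `Σ = fromBlocks Γ C (conj C) (conj Γ)`. -/
def augCov (Γ C : Matrix (Fin 2) (Fin 2) ℂ) : Matrix (Fin 4) (Fin 4) ℂ :=
  Matrix.reindex finSumFinEquiv finSumFinEquiv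
    (Matrix.fromBlocks Γ C (C.map (starRingEnd ℂ)) (Γ.map (starRingEnd ℂ)))

/-- The complex Gaussian density with mean `μ` and augmented covariance matrix `S`:
`f(z) = (π²·√(det S))⁻¹ · exp(−(1/2)·(z̲−μ̲)ᴴ S⁻¹ (z̲−μ̲))`. -/
def gaussDensity (μ : Fin 2 → ℂ) (S : Matrix (Fin 4) (Fin 4) ℂ) (z : Fin 2 → ℂ) : ℝ :=
  (Real.pi ^ 2 * Real.sqrt S.det.re)⁻¹ *
    Real.exp (-(1 / 2) * (star (aug z - aug μ) ⬝ᵥ (S⁻¹ *ᵥ (aug z - aug μ))).re)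

/-- The vector `𝐪 = (1, q)ᵀ ∈ ℂ²`. -/
def qvec (q : ℂ) : Fin 2 → ℂ := ![1, q]

/-- The Schur complement `P = conj Γ − (conj C)·Γ⁻¹·C`. -/
def schurP (Γ C : Matrix (Fin 2) (Fin 2) ℂ) : Matrix (Fin 2) (Fin 2) ℂ :=
  Γ.map (starRingEnd ℂ) - (C.map (starRingEnd ℂ)) * Γ⁻¹ * C

/-- The matrix `R = (conj C)·Γ⁻¹`. -/
def matR (Γ C : Matrix (Fin 2) (Fin 2) ℂ) : Matrix (Fin 2) (Fin 2) ℂ :=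
  (C.map (starRingEnd ℂ)) * Γ⁻¹

/-- `A(θ, q) = 𝐪ᴴ·conj(P⁻¹)·𝐪 − Re(e^{2iθ}·𝐪ᵀ·Rᵀ·conj(P⁻¹)·𝐪)`. -/
def Afun (Γ C : Matrix (Fin 2) (Fin 2) ℂ) (θ : ℝ) (q : ℂ) : ℝ :=
  (star (qvec q) ⬝ᵥ (((schurP Γ C)⁻¹.map (starRingEnd ℂ)) *ᵥ qvec q)).re -
    (Complex.exp (2 * Complex.I * θ) *
      (qvec q ⬝ᵥ (((matR Γ C)ᵀ * ((schurP Γ C)⁻¹.map (starRingEnd ℂ))) *ᵥ qvec q))).re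

/-- `B_μ(θ, q) = Re(e^{iθ}·(μᴴ − μᵀ·Rᵀ)·conj(P⁻¹)·𝐪)`. -/
def Bfun (μ : Fin 2 → ℂ) (Γ C : Matrix (Fin 2) (Fin 2) ℂ) (θ : ℝ) (q : ℂ) : ℝ :=
  (Complex.exp (Complex.I * θ) *
    (((star μ - μ ᵥ* (matR Γ C)ᵀ) ᵥ* ((schurP Γ C)⁻¹.map (starRingEnd ℂ))) ⬝ᵥ qvec q)).re

/-- The Kummer confluent hypergeometric function `₁F₁(a; b; x)`. -/
def oneFOne (a b x : ℝ) : ℝ :=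
  ∑' n : ℕ,
    ((∏ i ∈ Finset.range n, (a + i)) / (∏ i ∈ Finset.range n, (b + i))) * x ^ n / n.factorial

/-- The quotient density
`f_Q(q) = (e^{−(1/2)·μ̲ᴴΣ⁻¹μ̲} / (π²·√(det Γ · det P))) · ∫₀^π ₁F₁(2; 1/2; B_μ(θ,q)²/A(θ,q)) / A(θ,q)² dθ`. -/
def quotDensity (μ : Fin 2 → ℂ) (Γ C : Matrix (Fin 2) (Fin 2) ℂ) (q : ℂ) : ℝ :=
  (Real.exp (-(1 / 2) * (star (aug μ) ⬝ᵥ ((augCov Γ C)⁻¹ *ᵥ aug μ)).re) /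
      (Real.pi ^ 2 * Real.sqrt (Γ.det.re * (schurP Γ C).det.re))) *
    ∫ θ in (0 : ℝ)..Real.pi,
      oneFOne 2 (1 / 2) ((Bfun μ Γ C θ q) ^ 2 / Afun Γ C θ q) / (Afun Γ C θ q) ^ 2

lemma oneFOne_coeff_nonneg (n : ℕ) :
    0 ≤ (∏ i ∈ Finset.range n, ((2 : ℝ) + i)) / (∏ i ∈ Finset.range n, ((1 / 2 : ℝ) + i)) := by
  positivity

lemma oneFOne_coeff_le (n : ℕ) :
    (∏ i ∈ Finset.range n, ((2 : ℝ) + i)) / (∏ i ∈ Finset.range n, ((1 / 2 : ℝ) + i)) ≤ 4 ^ n := by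
  rw [← Finset.prod_div_distrib]
  calc _ ≤ ∏ _i ∈ Finset.range n, (4 : ℝ) := by
        refine Finset.prod_le_prod (fun i _ => by positivity) fun i _ => ?_
        rw [div_le_iff₀ (by positivity)]
        have : (0 : ℝ) ≤ i := by positivity
        linarith
    _ = 4 ^ n := by simp

lemma oneFOne_coeff_eq (n : ℕ) :
    (∏ i ∈ Finset.range n, ((2 : ℝ) + i)) / (∏ i ∈ Finset.range n, ((1 / 2 : ℝ) + i)) =
      4 ^ n * (n + 1).factorial * n.factorial / (2 * n).factorial := by
  induction n with
  | zero => simp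
  | succ n ih =>
    rw [Finset.prod_range_succ, Finset.prod_range_succ, mul_div_mul_comm, ih]
    rw [show 2 * (n + 1) = 2 * n + 1 + 1 by ring]
    simp only [Nat.factorial_succ]
    push_cast
    have : ((2 * n).factorial : ℝ) ≠ 0 := by positivity
    field_simp
    ring

lemma norm_oneFOne_term_le (n : ℕ) {x K : ℝ} (hx : |x| ≤ K) :
    ‖((∏ i ∈ Finset.range n, ((2 : ℝ) + i)) / (∏ i ∈ Finset.range n, ((1 / 2 : ℝ) + i))) * x ^ n /
      n.factorial‖ ≤ (4 * K) ^ n / n.factorial := by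
  rw [norm_div, norm_mul, Real.norm_of_nonneg (oneFOne_coeff_nonneg n), norm_pow, Real.norm_eq_abs,
    Real.norm_of_nonneg (by positivity : (0 : ℝ) ≤ n.factorial), mul_pow]
  gcongr
  exact oneFOne_coeff_le n

lemma summable_oneFOne (x : ℝ) :
    Summable fun n : ℕ => ((∏ i ∈ Finset.range n, ((2 : ℝ) + i)) /
      (∏ i ∈ Finset.range n, ((1 / 2 : ℝ) + i))) * x ^ n / n.factorial :=
  .of_norm_bounded (Real.summable_pow_div_factorial (4 * |x|))
    fun n => norm_oneFOne_term_le n le_rfl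

lemma continuous_oneFOne : Continuous (oneFOne 2 (1 / 2)) := by
  rw [continuous_iff_continuousAt]
  intro x
  have : ContinuousOn (oneFOne 2 (1 / 2)) (Metric.closedBall 0 (|x| + 1)) := by
    refine continuousOn_tsum (fun n => by fun_prop)
      (Real.summable_pow_div_factorial (4 * (|x| + 1))) fun n y hy => norm_oneFOne_term_le n ?_
    simpa using hy
  refine this.continuousAt (Metric.closedBall_mem_nhds_of_mem ?_)
  simp

lemma oneFOne_nonneg {x : ℝ} (hx : 0 ≤ x) : 0 ≤ oneFOne 2 (1 / 2) x :=
  tsum_nonneg fun n => div_nonneg (mul_nonneg (oneFOne_coeff_nonneg n) (by positivity))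
    (by positivity)

lemma lintegral_pow_mul_exp_neg_mul_sq {a : ℝ} (ha : 0 < a) (n : ℕ) :
    ∫⁻ r in Set.Ioi (0 : ℝ), ENNReal.ofReal (r ^ (2 * n + 3) * Real.exp (-a * r ^ 2)) =
      ENNReal.ofReal ((n + 1).factorial / (2 * a ^ (n + 2))) := by
  have hi := integrableOn_rpow_mul_exp_neg_mul_sq ha
    (s := ((2 * n + 3 : ℕ) : ℝ)) (by push_cast; linarith [(Nat.cast_nonneg n : (0 : ℝ) ≤ n)])
  have hv := integral_rpow_mul_exp_neg_mul_rpow (p := 2) (q := ((2 * n + 3 : ℕ) : ℝ)) (b := a)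
    two_pos (by push_cast; linarith [(Nat.cast_nonneg n : (0 : ℝ) ≤ n)]) ha
  simp only [Real.rpow_natCast, Real.rpow_two] at hi hv
  rw [← ofReal_integral_eq_lintegral_ofReal hi, hv]
  · congr 1
    have h1 : (((2 * n + 3 : ℕ) : ℝ) + 1) / 2 = ((n + 1 : ℕ) : ℝ) + 1 := by push_cast; ring
    have h2 : -(((2 * n + 3 : ℕ) : ℝ) + 1) / 2 = -((n + 2 : ℕ) : ℝ) := by push_cast; ring
    rw [h1, h2, Real.Gamma_nat_eq_factorial, Real.rpow_neg ha.le, Real.rpow_natCast]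
    field_simp
  · filter_upwards [ae_restrict_mem measurableSet_Ioi] with r hr
    have : 0 < r := hr
    simp only [Pi.zero_apply]
    positivity

/-- The radial integrals along a direction and its opposite add up to a Kummer function. -/
lemma lintegral_radial_add {a : ℝ} (ha : 0 < a) (b : ℝ) :
    (∫⁻ r in Set.Ioi (0 : ℝ), ENNReal.ofReal (r ^ 3 * Real.exp (-a * r ^ 2 + 2 * b * r))) +
      (∫⁻ r in Set.Ioi (0 : ℝ), ENNReal.ofReal (r ^ 3 * Real.exp (-a * r ^ 2 - 2 * b * r))) =
      ENNReal.ofReal (oneFOne 2 (1 / 2) (b ^ 2 / a) / a ^ 2) := by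
  rw [← lintegral_add_left (by fun_prop)]
  have key : ∀ r ∈ Set.Ioi (0 : ℝ),
      ENNReal.ofReal (r ^ 3 * Real.exp (-a * r ^ 2 + 2 * b * r)) +
        ENNReal.ofReal (r ^ 3 * Real.exp (-a * r ^ 2 - 2 * b * r)) =
      ∑' n : ℕ, ENNReal.ofReal (2 * (2 * b) ^ (2 * n) / (2 * n).factorial) *
        ENNReal.ofReal (r ^ (2 * n + 3) * Real.exp (-a * r ^ 2)) := by
    intro r hr
    have hr : 0 < r := hr
    have hs := (Real.hasSum_cosh (2 * b * r)).mul_left (2 * r ^ 3 * Real.exp (-a * r ^ 2))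
    rw [← ENNReal.ofReal_add (by positivity) (by positivity)]
    have hn : ∀ n : ℕ, (0 : ℝ) ≤ 2 * (2 * b) ^ (2 * n) / (2 * n).factorial := fun n => by
      rw [pow_mul]; positivity
    simp_rw [← fun n => ENNReal.ofReal_mul (hn n)
      (q := r ^ (2 * n + 3) * Real.exp (-a * r ^ 2))]
    have he : ∀ n : ℕ, 2 * (2 * b) ^ (2 * n) / (2 * n).factorial *
        (r ^ (2 * n + 3) * Real.exp (-a * r ^ 2)) =
        2 * r ^ 3 * Real.exp (-a * r ^ 2) * ((2 * b * r) ^ (2 * n) / (2 * n).factorial) := by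
      intro n
      rw [mul_pow (2 * b) r]
      ring
    rw [← ENNReal.ofReal_tsum_of_nonneg (fun n => mul_nonneg (hn n) (by positivity))]
    · congr 1
      simp_rw [he]
      rw [hs.tsum_eq, Real.cosh_eq, sub_eq_add_neg (-a * r ^ 2), Real.exp_add, Real.exp_add]
      ring
    · simp_rw [he]
      exact hs.summable
  rw [setLIntegral_congr_fun measurableSet_Ioi key, lintegral_tsum (fun n => by fun_prop)]
  have hc : ∀ n : ℕ, ∫⁻ r in Set.Ioi (0 : ℝ),
      ENNReal.ofReal (2 * (2 * b) ^ (2 * n) / (2 * n).factorial) *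
        ENNReal.ofReal (r ^ (2 * n + 3) * Real.exp (-a * r ^ 2)) =
      ENNReal.ofReal (((∏ i ∈ Finset.range n, ((2 : ℝ) + i)) /
        (∏ i ∈ Finset.range n, ((1 / 2 : ℝ) + i))) * (b ^ 2 / a) ^ n / n.factorial / a ^ 2) := by
    intro n
    rw [lintegral_const_mul _ (by fun_prop), lintegral_pow_mul_exp_neg_mul_sq ha,
      ← ENNReal.ofReal_mul (by rw [pow_mul]; positivity), oneFOne_coeff_eq]
    congr 1
    have : ((2 * n).factorial : ℝ) ≠ 0 := by positivity
    have : (n.factorial : ℝ) ≠ 0 := by positivity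
    rw [pow_mul, mul_pow 2 b, mul_pow, div_pow]
    field_simp
    norm_num
    ring
  simp_rw [hc]
  rw [← ENNReal.ofReal_tsum_of_nonneg _ ((summable_oneFOne _).div_const _), tsum_div_const]
  · rfl
  · intro n
    have := oneFOne_coeff_nonneg n
    positivity

lemma lintegral_eq_lintegral_comp_mul_left {w : ℂ} (hw : w ≠ 0) {F : ℂ → ENNReal}
    (hF : Measurable F) :
    ∫⁻ z, F z = ENNReal.ofReal (‖w‖ ^ 2) * ∫⁻ q, F (w * q) := by
  have hd : LinearMap.det (LinearMap.mul ℝ ℂ w) = ‖w‖ ^ 2 := by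
    rw [← Complex.normSq_eq_norm_sq, ← Algebra.norm_complex_apply, Algebra.norm_apply]
    rfl
  have hpos : 0 < ‖w‖ ^ 2 := by positivity
  have hm := Measure.map_linearMap_addHaar_eq_smul_addHaar (volume : Measure ℂ)
    (f := LinearMap.mul ℝ ℂ w) (by rw [hd]; exact hpos.ne')
  have hcoe : (⇑(LinearMap.mul ℝ ℂ w) : ℂ → ℂ) = fun q => w * q := by ext; simp
  rw [hd, hcoe] at hm
  rw [← lintegral_map hF (measurable_const_mul w), hm, lintegral_smul_measure, smul_eq_mul,
    ← mul_assoc, ← ENNReal.ofReal_mul hpos.le, abs_of_pos (inv_pos.2 hpos),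
    mul_inv_cancel₀ hpos.ne', ENNReal.ofReal_one, one_mul]

/-- The quotient of the two coordinates of a measure on `ℂ²` with density `f` has density
`q ↦ ∫ ‖w‖² f(w, w q) dw`. -/
lemma map_quotient_withDensity {f : (Fin 2 → ℂ) → ENNReal} (hf : Measurable f) :
    Measure.map (fun z : Fin 2 → ℂ => z 1 / z 0) (volume.withDensity f) =
      (volume : Measure ℂ).withDensity
        fun q => ∫⁻ w : ℂ, ENNReal.ofReal (‖w‖ ^ 2) * f (w • qvec q) := by
  have hq : Measurable fun z : Fin 2 → ℂ => z 1 / z 0 := by fun_prop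
  have hpair : Measurable fun p : ℂ × ℂ => (![p.1, p.2] : Fin 2 → ℂ) :=
    (MeasurableEquiv.finTwoArrow (α := ℂ)).symm.measurable
  have hsm : ∀ w q : ℂ, w • qvec q = ![w, w * q] := fun w q => by
    ext i; fin_cases i <;> simp [qvec]
  ext s hs
  rw [Measure.map_apply hq hs, withDensity_apply _ (hq hs), withDensity_apply _ hs,
    ← lintegral_indicator (hq hs), ← lintegral_indicator hs]
  rw [← ((volume_preserving_finTwoArrow ℂ).symm).lintegral_comp_emb
    MeasurableEquiv.finTwoArrow.symm.measurableEmbedding]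
  have hG : Measurable fun p : ℂ × ℂ =>
      ((fun z : Fin 2 → ℂ => z 1 / z 0) ⁻¹' s).indicator f ![p.1, p.2] :=
    (hf.indicator (hq hs)).comp hpair
  have hH : Measurable fun p : ℂ × ℂ =>
      s.indicator (fun q => ENNReal.ofReal (‖p.1‖ ^ 2) * f (p.1 • qvec q)) p.2 := by
    have : Measurable fun p : ℂ × ℂ => ENNReal.ofReal (‖p.1‖ ^ 2) * f (p.1 • qvec p.2) := by
      simp_rw [hsm]
      have : Measurable fun p : ℂ × ℂ => f ![p.1, p.1 * p.2] :=
        (hf.comp hpair).comp (g := fun p : ℂ × ℂ => f ![p.1, p.2])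
          (f := fun p : ℂ × ℂ => (p.1, p.1 * p.2)) (by fun_prop)
      fun_prop
    exact this.indicator (measurable_snd hs)
  calc ∫⁻ p : ℂ × ℂ, ((fun z : Fin 2 → ℂ => z 1 / z 0) ⁻¹' s).indicator f ![p.1, p.2]
      = ∫⁻ w : ℂ, ∫⁻ z : ℂ, ((fun z : Fin 2 → ℂ => z 1 / z 0) ⁻¹' s).indicator f ![w, z] :=
        lintegral_prod _ hG.aemeasurable
    _ = ∫⁻ w : ℂ, ∫⁻ q : ℂ,
          s.indicator (fun q => ENNReal.ofReal (‖w‖ ^ 2) * f (w • qvec q)) q := by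
        refine lintegral_congr_ae ?_
        have h0 : ∀ᵐ w : ℂ, w ≠ 0 := by simp [ae_iff]
        filter_upwards [h0] with w hw
        have hGw : Measurable fun z : ℂ =>
            ((fun z : Fin 2 → ℂ => z 1 / z 0) ⁻¹' s).indicator f ![w, z] :=
          hG.comp measurable_prodMk_left
        rw [lintegral_eq_lintegral_comp_mul_left hw hGw,
          ← lintegral_const_mul]
        · refine lintegral_congr fun q => ?_
          by_cases hqs : q ∈ s <;> simp [Set.indicator, hw, hqs, hsm]
        · exact hGw.comp (measurable_const_mul w)
    _ = ∫⁻ q : ℂ, ∫⁻ w : ℂ,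
          s.indicator (fun q => ENNReal.ofReal (‖w‖ ^ 2) * f (w • qvec q)) q :=
        lintegral_lintegral_swap hH.aemeasurable
    _ = _ := by
        refine lintegral_congr fun q => ?_
        by_cases hqs : q ∈ s <;> simp [hqs]

/-- An integral over the plane in polar coordinates, grouping opposite directions. -/
lemma lintegral_complex_eq_lintegral_opposite_rays {F : ℂ → ENNReal} (hF : Measurable F) :
    ∫⁻ w, F w = ∫⁻ θ in Set.Ioo 0 Real.pi,
      ((∫⁻ r in Set.Ioi (0 : ℝ), ENNReal.ofReal r * F (r * Complex.exp (Complex.I * θ))) +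
        ∫⁻ r in Set.Ioi (0 : ℝ), ENNReal.ofReal r * F (-(r * Complex.exp (Complex.I * θ)))) := by
  have hsymm : ∀ p : ℝ × ℝ, Complex.polarCoord.symm p = p.1 * Complex.exp (Complex.I * p.2) := by
    intro p
    rw [Complex.polarCoord_symm_apply, mul_comm Complex.I, Complex.exp_mul_I]
    push_cast
    ring
  set J : ℝ → ENNReal := fun θ =>
    ∫⁻ r in Set.Ioi (0 : ℝ), ENNReal.ofReal r * F (r * Complex.exp (Complex.I * θ)) with hJ
  have hm : Measurable fun p : ℝ × ℝ =>
      ENNReal.ofReal p.1 * F (p.1 * Complex.exp (Complex.I * p.2)) := by fun_prop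
  have hJm : Measurable J :=
    Measurable.lintegral_prod_left' (f := fun p : ℝ × ℝ =>
      ENNReal.ofReal p.1 * F (p.1 * Complex.exp (Complex.I * p.2))) hm
  have hneg : ∀ θ : ℝ, J (θ - Real.pi) =
      ∫⁻ r in Set.Ioi (0 : ℝ), ENNReal.ofReal r * F (-(r * Complex.exp (Complex.I * θ))) := by
    intro θ
    simp only [hJ]
    refine lintegral_congr fun r => ?_
    rw [show Complex.I * ((θ - Real.pi : ℝ) : ℂ) = Complex.I * θ - Real.pi * Complex.I by
      push_cast; ring, Complex.exp_sub, Complex.exp_pi_mul_I, div_neg, div_one, mul_neg]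
  rw [← Complex.lintegral_comp_polarCoord_symm, polarCoord_target]
  simp_rw [hsymm, smul_eq_mul]
  rw [Measure.volume_eq_prod, ← Measure.prod_restrict,
    lintegral_prod_symm _ hm.aemeasurable]
  simp_rw [← hneg]
  change ∫⁻ θ in Set.Ioo (-Real.pi) Real.pi, J θ =
    ∫⁻ θ in Set.Ioo 0 Real.pi, (J θ + J (θ - Real.pi))
  have hpi := Real.pi_pos
  rw [lintegral_add_left hJm,
    ← Set.Ioc_union_Ioo_eq_Ioo (neg_neg_of_pos hpi).le hpi,
    lintegral_union measurableSet_Ioo, add_comm]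
  · congr 1
    rw [setLIntegral_congr (Ioo_ae_eq_Ioc (α := ℝ) (μ := volume)).symm,
      ← lintegral_indicator measurableSet_Ioo, ← lintegral_indicator measurableSet_Ioo,
      ← lintegral_sub_right_eq_self _ Real.pi]
    refine lintegral_congr fun θ => ?_
    have : θ - Real.pi ∈ Set.Ioo (-Real.pi) 0 ↔ θ ∈ Set.Ioo 0 Real.pi := by
      simp only [Set.mem_Ioo]
      constructor <;> rintro ⟨h1, h2⟩ <;> constructor <;> linarith
    simp only [Set.indicator, this]
  · rw [Set.disjoint_left]
    rintro x ⟨_, h1⟩ ⟨h2, _⟩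
    linarith

lemma map_conj_mul (M N : Matrix (Fin 2) (Fin 2) ℂ) :
    (M * N).map (starRingEnd ℂ) = M.map (starRingEnd ℂ) * N.map (starRingEnd ℂ) :=
  Matrix.map_mul

lemma map_conj_sub (M N : Matrix (Fin 2) (Fin 2) ℂ) :
    (M - N).map (starRingEnd ℂ) = M.map (starRingEnd ℂ) - N.map (starRingEnd ℂ) :=
  Matrix.map_sub _ (map_sub _) _ _

lemma map_conj_map_conj (M : Matrix (Fin 2) (Fin 2) ℂ) :
    (M.map (starRingEnd ℂ)).map (starRingEnd ℂ) = M := by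
  ext; simp

lemma map_conj_one :
    (1 : Matrix (Fin 2) (Fin 2) ℂ).map (starRingEnd ℂ) = 1 :=
  Matrix.map_one _ (map_zero _) (map_one _)

lemma det_augCov {Γ : Matrix (Fin 2) (Fin 2) ℂ} (C : Matrix (Fin 2) (Fin 2) ℂ)
    (hΓ : Γ.det ≠ 0) : (augCov Γ C).det = Γ.det * (schurP Γ C).det := by
  let : Invertible Γ := Matrix.invertibleOfIsUnitDet _ (isUnit_iff_ne_zero.2 hΓ)
  rw [augCov, Matrix.det_reindex_self, Matrix.det_fromBlocks₁₁, Matrix.invOf_eq_nonsing_inv]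
  rfl

lemma inv_augCov {Γ C : Matrix (Fin 2) (Fin 2) ℂ} (hΓ : IsUnit Γ.det)
    (hP : IsUnit (schurP Γ C).det) :
    (augCov Γ C)⁻¹ = Matrix.reindex finSumFinEquiv finSumFinEquiv
      (Matrix.fromBlocks ((schurP Γ C)⁻¹.map (starRingEnd ℂ))
        (-((schurP Γ C)⁻¹ * matR Γ C).map (starRingEnd ℂ))
        (-((schurP Γ C)⁻¹ * matR Γ C)) (schurP Γ C)⁻¹) := by
  refine Matrix.inv_eq_left_inv ?_
  set Q := (schurP Γ C)⁻¹
  have h21 : -(Q * matR Γ C) * Γ + Q * C.map (starRingEnd ℂ) = 0 := by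
    rw [matR, neg_mul, Matrix.mul_assoc, Matrix.mul_assoc, Matrix.nonsing_inv_mul _ hΓ,
      Matrix.mul_one, neg_add_cancel]
  have h22 : -(Q * matR Γ C) * C + Q * Γ.map (starRingEnd ℂ) = 1 := by
    have : Q * schurP Γ C = 1 := Matrix.nonsing_inv_mul _ hP
    rw [← this, schurP, Matrix.mul_sub, matR, neg_mul, Matrix.mul_assoc Q, neg_add_eq_sub]
  have h11 := congrArg (fun M => M.map (starRingEnd ℂ)) h22
  have h12 := congrArg (fun M => M.map (starRingEnd ℂ)) h21
  have hadd : ∀ M N : Matrix (Fin 2) (Fin 2) ℂ, (M + N).map (starRingEnd ℂ) =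
      M.map (starRingEnd ℂ) + N.map (starRingEnd ℂ) := fun M N => Matrix.map_add _ (map_add _) M N
  have hneg : ∀ M : Matrix (Fin 2) (Fin 2) ℂ, (-M).map (starRingEnd ℂ) =
      -M.map (starRingEnd ℂ) := fun M => by ext; simp
  simp only [hadd, map_conj_mul, hneg, map_conj_map_conj, map_conj_one] at h11 h12
  rw [add_comm] at h11 h12
  rw [augCov, Matrix.reindex_apply, Matrix.reindex_apply, Matrix.submatrix_mul_equiv,
    Matrix.fromBlocks_multiply, h21, h22, map_conj_mul, h11, h12,
    Matrix.map_zero _ (map_zero _), Matrix.fromBlocks_one, Matrix.submatrix_one_equiv]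

lemma isUnit_det_of_augCov {Γ C : Matrix (Fin 2) (Fin 2) ℂ} (hΓ : Γ.PosDef)
    (hS : (augCov Γ C).PosDef) : IsUnit Γ.det ∧ IsUnit (schurP Γ C).det := by
  have hΓ' := hΓ.det_pos.ne'
  have h := hS.det_pos.ne'
  rw [det_augCov C hΓ'] at h
  exact ⟨isUnit_iff_ne_zero.2 hΓ', isUnit_iff_ne_zero.2 (right_ne_zero_of_mul h)⟩

lemma inv_schurP_mul_matR {Γ C : Matrix (Fin 2) (Fin 2) ℂ} (hΓ : Γ.PosDef) (hC : Cᵀ = C)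
    (hP : IsUnit (schurP Γ C).det) :
    (schurP Γ C)⁻¹ * matR Γ C = (matR Γ C)ᵀ * (schurP Γ C)⁻¹.map (starRingEnd ℂ) := by
  have hΓu : IsUnit Γ.det := isUnit_iff_ne_zero.2 hΓ.det_pos.ne'
  have hT : Γᵀ = Γ.map (starRingEnd ℂ) := by
    conv_lhs => rw [← hΓ.isHermitian.eq]
    ext; simp
  have hCT : (C.map (starRingEnd ℂ))ᵀ = C.map (starRingEnd ℂ) := by
    rw [← Matrix.transpose_map, hC]
  have hRT : (matR Γ C)ᵀ = (Γ.map (starRingEnd ℂ))⁻¹ * C.map (starRingEnd ℂ) := by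
    rw [matR, Matrix.transpose_mul, Matrix.transpose_nonsing_inv, hT, hCT]
  have hΓc : IsUnit (Γ.map (starRingEnd ℂ)).det := by rwa [← hT, Matrix.det_transpose]
  have hinv : Γ⁻¹.map (starRingEnd ℂ) = (Γ.map (starRingEnd ℂ))⁻¹ := by
    symm
    apply Matrix.inv_eq_left_inv
    rw [← map_conj_mul, Matrix.nonsing_inv_mul _ hΓu, map_conj_one]
  have hcomm : matR Γ C * (schurP Γ C).map (starRingEnd ℂ) = schurP Γ C * (matR Γ C)ᵀ := by
    rw [hRT, schurP, map_conj_sub, map_conj_mul, map_conj_mul, map_conj_map_conj,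
      map_conj_map_conj, hinv, matR, Matrix.mul_sub, Matrix.sub_mul,
      Matrix.nonsing_inv_mul_cancel_right _ _ hΓu, Matrix.mul_nonsing_inv_cancel_left _ _ hΓc]
    simp only [Matrix.mul_assoc]
  have hPc : (schurP Γ C).map (starRingEnd ℂ) * (schurP Γ C)⁻¹.map (starRingEnd ℂ) = 1 := by
    rw [← map_conj_mul, Matrix.mul_nonsing_inv _ hP, map_conj_one]
  calc (schurP Γ C)⁻¹ * matR Γ C
      = (schurP Γ C)⁻¹ * (matR Γ C * (schurP Γ C).map (starRingEnd ℂ)) *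
          (schurP Γ C)⁻¹.map (starRingEnd ℂ) := by
        rw [Matrix.mul_assoc, Matrix.mul_assoc, hPc, Matrix.mul_one]
    _ = _ := by rw [hcomm, Matrix.nonsing_inv_mul_cancel_left _ _ hP]

lemma aug_form_fromBlocks (H K : Matrix (Fin 2) (Fin 2) ℂ) (x y : Fin 2 → ℂ) :
    (star (aug x) ⬝ᵥ (Matrix.reindex finSumFinEquiv finSumFinEquiv
      (Matrix.fromBlocks (H.map (starRingEnd ℂ)) (-K.map (starRingEnd ℂ)) (-K) H) *ᵥ aug y)).re =
      2 * ((star x ⬝ᵥ (H.map (starRingEnd ℂ) *ᵥ y)) - x ⬝ᵥ (K *ᵥ y)).re := by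
  have h0 : (finSumFinEquiv (m := 2) (n := 2)).symm 0 = Sum.inl 0 := rfl
  have h1 : (finSumFinEquiv (m := 2) (n := 2)).symm 1 = Sum.inl 1 := rfl
  have h2 : (finSumFinEquiv (m := 2) (n := 2)).symm 2 = Sum.inr 0 := rfl
  have h3 : (finSumFinEquiv (m := 2) (n := 2)).symm 3 = Sum.inr 1 := rfl
  simp [dotProduct, Matrix.mulVec, Fin.sum_univ_four, Fin.sum_univ_two, aug, h0, h1, h2, h3]
  ring

/-- The real form `Re(x̲ᴴ Σ⁻¹ y̲)` in terms of the Schur complement. -/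
lemma augCov_form {Γ C : Matrix (Fin 2) (Fin 2) ℂ} (hΓ : Γ.PosDef) (hC : Cᵀ = C)
    (hS : (augCov Γ C).PosDef) (x y : Fin 2 → ℂ) :
    (star (aug x) ⬝ᵥ ((augCov Γ C)⁻¹ *ᵥ aug y)).re =
      2 * ((star x ⬝ᵥ ((schurP Γ C)⁻¹.map (starRingEnd ℂ) *ᵥ y)) -
        x ⬝ᵥ (((matR Γ C)ᵀ * (schurP Γ C)⁻¹.map (starRingEnd ℂ)) *ᵥ y)).re := by
  obtain ⟨hΓu, hP⟩ := isUnit_det_of_augCov hΓ hS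
  rw [inv_augCov hΓu hP, aug_form_fromBlocks, inv_schurP_mul_matR hΓ hC hP]

lemma augCov_form_smul_qvec {Γ C : Matrix (Fin 2) (Fin 2) ℂ} (hΓ : Γ.PosDef) (hC : Cᵀ = C)
    (hS : (augCov Γ C).PosDef) (r θ : ℝ) (q : ℂ) :
    (star (aug ((r * Complex.exp (Complex.I * θ)) • qvec q)) ⬝ᵥ ((augCov Γ C)⁻¹ *ᵥ
      aug ((r * Complex.exp (Complex.I * θ)) • qvec q))).re = 2 * (r ^ 2 * Afun Γ C θ q) := by
  rw [augCov_form hΓ hC hS, Afun]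
  have he : Complex.exp (2 * Complex.I * θ) =
      Complex.exp (Complex.I * θ) * Complex.exp (Complex.I * θ) := by
    rw [← Complex.exp_add]; ring_nf
  have hc : starRingEnd ℂ (Complex.exp (Complex.I * θ)) * Complex.exp (Complex.I * θ) = 1 := by
    rw [← Complex.exp_conj, ← Complex.exp_add]; simp
  rw [he]
  simp only [star_smul, smul_dotProduct, Matrix.mulVec_smul, dotProduct_smul, smul_eq_mul,
    Complex.star_def, map_mul, Complex.conj_ofReal]
  congr 1
  rw [← Complex.sub_re, ← Complex.re_ofReal_mul]
  congr 1
  push_cast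
  linear_combination (r : ℂ) ^ 2 * (star (qvec q) ⬝ᵥ
    ((schurP Γ C)⁻¹.map (starRingEnd ℂ) *ᵥ qvec q)) * hc

lemma augCov_form_mean {Γ C : Matrix (Fin 2) (Fin 2) ℂ} (hΓ : Γ.PosDef) (hC : Cᵀ = C)
    (hS : (augCov Γ C).PosDef) (μ : Fin 2 → ℂ) (r θ : ℝ) (q : ℂ) :
    (star (aug μ) ⬝ᵥ ((augCov Γ C)⁻¹ *ᵥ aug ((r * Complex.exp (Complex.I * θ)) • qvec q))).re =
      2 * (r * Bfun μ Γ C θ q) := by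
  rw [augCov_form hΓ hC hS, Bfun]
  congr 1
  rw [← Complex.re_ofReal_mul]
  congr 1
  simp only [Matrix.mulVec_smul, dotProduct_smul, smul_eq_mul, Matrix.sub_vecMul,
    sub_dotProduct, Matrix.vecMul_vecMul, ← Matrix.dotProduct_mulVec]
  ring

lemma re_form_comm {S : Matrix (Fin 4) (Fin 4) ℂ} (hS : S.IsHermitian) (x y : Fin 4 → ℂ) :
    (star x ⬝ᵥ (S *ᵥ y)).re = (star y ⬝ᵥ (S *ᵥ x)).re := by
  have : star (star x ⬝ᵥ (S *ᵥ y)) = star y ⬝ᵥ (S *ᵥ x) := by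
    rw [← Matrix.star_dotProduct_star, star_star, Matrix.star_mulVec, hS.eq,
      ← Matrix.dotProduct_mulVec]
  rw [← this]
  simp

lemma Afun_pos {Γ C : Matrix (Fin 2) (Fin 2) ℂ} (hΓ : Γ.PosDef) (hC : Cᵀ = C)
    (hS : (augCov Γ C).PosDef) (θ : ℝ) (q : ℂ) : 0 < Afun Γ C θ q := by
  have hne : aug (((1 : ℝ) * Complex.exp (Complex.I * θ)) • qvec q) ≠ 0 := by
    intro h
    have := congrFun h 0
    simp [aug, qvec] at this
  have h := (Complex.pos_iff.1 (hS.inv.dotProduct_mulVec_pos hne)).1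
  rw [augCov_form_smul_qvec hΓ hC hS] at h
  linarith

lemma gaussDensity_smul_qvec {Γ C : Matrix (Fin 2) (Fin 2) ℂ} (hΓ : Γ.PosDef) (hC : Cᵀ = C)
    (hS : (augCov Γ C).PosDef) (μ : Fin 2 → ℂ) (r θ : ℝ) (q : ℂ) :
    gaussDensity μ (augCov Γ C) ((r * Complex.exp (Complex.I * θ)) • qvec q) =
      Real.exp (-(1 / 2) * (star (aug μ) ⬝ᵥ ((augCov Γ C)⁻¹ *ᵥ aug μ)).re) /
        (Real.pi ^ 2 * Real.sqrt (Γ.det.re * (schurP Γ C).det.re)) *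
      Real.exp (-Afun Γ C θ q * r ^ 2 + 2 * Bfun μ Γ C θ q * r) := by
  have hdet : (augCov Γ C).det.re = Γ.det.re * (schurP Γ C).det.re := by
    rw [det_augCov C hΓ.det_pos.ne', Complex.mul_re, ← (Complex.pos_iff.1 hΓ.det_pos).2]
    simp
  rw [gaussDensity, hdet, div_mul_eq_mul_div, ← Real.exp_add, inv_mul_eq_div]
  congr 2
  rw [star_sub, Matrix.mulVec_sub, sub_dotProduct, dotProduct_sub, dotProduct_sub]
  simp only [Complex.sub_re]
  rw [re_form_comm hS.inv.isHermitian _ (aug μ), augCov_form_smul_qvec hΓ hC hS,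
    augCov_form_mean hΓ hC hS]
  ring

lemma measurable_gaussDensity (μ : Fin 2 → ℂ) (S : Matrix (Fin 4) (Fin 4) ℂ) :
    Measurable (gaussDensity μ S) := by
  have haug : Continuous aug := by
    refine continuous_pi fun i => ?_
    fin_cases i <;> simp [aug] <;> fun_prop
  have : Continuous (gaussDensity μ S) := by
    unfold gaussDensity
    fun_prop
  exact this.measurable

lemma continuous_quotDensity_integrand {Γ C : Matrix (Fin 2) (Fin 2) ℂ} (hΓ : Γ.PosDef)
    (hC : Cᵀ = C) (hS : (augCov Γ C).PosDef) (μ : Fin 2 → ℂ) (q : ℂ) :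
    Continuous fun θ : ℝ =>
      oneFOne 2 (1 / 2) ((Bfun μ Γ C θ q) ^ 2 / Afun Γ C θ q) / (Afun Γ C θ q) ^ 2 := by
  have hA : Continuous fun θ : ℝ => Afun Γ C θ q := by unfold Afun; fun_prop
  have hB : Continuous fun θ : ℝ => Bfun μ Γ C θ q := by unfold Bfun; fun_prop
  have hA0 : ∀ θ, Afun Γ C θ q ≠ 0 := fun θ => (Afun_pos hΓ hC hS θ q).ne'
  exact (continuous_oneFOne.comp ((hB.pow 2).div hA hA0)).div (hA.pow 2)
    fun θ => pow_ne_zero 2 (hA0 θ)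

lemma lintegral_gaussDensity_smul_qvec {Γ C : Matrix (Fin 2) (Fin 2) ℂ} (hΓ : Γ.PosDef)
    (hC : Cᵀ = C) (hS : (augCov Γ C).PosDef) (μ : Fin 2 → ℂ) (q : ℂ) :
    ∫⁻ w : ℂ, ENNReal.ofReal (‖w‖ ^ 2) *
      ENNReal.ofReal (gaussDensity μ (augCov Γ C) (w • qvec q)) =
      ENNReal.ofReal (quotDensity μ Γ C q) := by
  have hmeas := measurable_gaussDensity μ (augCov Γ C)
  rw [lintegral_complex_eq_lintegral_opposite_rays (by fun_prop), quotDensity]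
  set k := Real.exp (-(1 / 2) * (star (aug μ) ⬝ᵥ ((augCov Γ C)⁻¹ *ᵥ aug μ)).re) /
        (Real.pi ^ 2 * Real.sqrt (Γ.det.re * (schurP Γ C).det.re)) with hk
  have hk0 : 0 ≤ k := by positivity
  have hray : ∀ θ r : ℝ, 0 < r → ∀ ε : ℝ, ε ^ 2 = 1 →
      ENNReal.ofReal r * (ENNReal.ofReal (‖((ε * r : ℝ) : ℂ) * Complex.exp (Complex.I * θ)‖ ^ 2) *
        ENNReal.ofReal (gaussDensity μ (augCov Γ C)
          ((((ε * r : ℝ) : ℂ) * Complex.exp (Complex.I * θ)) • qvec q))) =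
      ENNReal.ofReal k * ENNReal.ofReal (r ^ 3 *
        Real.exp (-Afun Γ C θ q * r ^ 2 + 2 * (ε * Bfun μ Γ C θ q) * r)) := by
    intro θ r hr ε hε
    rw [gaussDensity_smul_qvec hΓ hC hS, ← ENNReal.ofReal_mul (by positivity),
      ← ENNReal.ofReal_mul hr.le, ← ENNReal.ofReal_mul hk0, norm_mul,
      mul_comm Complex.I, Complex.norm_exp_ofReal_mul_I, Complex.norm_real, mul_one,
      Real.norm_eq_abs, sq_abs, mul_pow ε r, hε]
    congr 1
    rw [← hk]
    ring_nf
  have hθ : ∀ θ : ℝ,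
      ((∫⁻ r in Set.Ioi (0 : ℝ), ENNReal.ofReal r *
          (ENNReal.ofReal (‖(r : ℂ) * Complex.exp (Complex.I * θ)‖ ^ 2) *
            ENNReal.ofReal (gaussDensity μ (augCov Γ C)
              (((r : ℂ) * Complex.exp (Complex.I * θ)) • qvec q)))) +
        ∫⁻ r in Set.Ioi (0 : ℝ), ENNReal.ofReal r *
          (ENNReal.ofReal (‖-((r : ℂ) * Complex.exp (Complex.I * θ))‖ ^ 2) *
            ENNReal.ofReal (gaussDensity μ (augCov Γ C)
              ((-((r : ℂ) * Complex.exp (Complex.I * θ))) • qvec q)))) =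
      ENNReal.ofReal k * ENNReal.ofReal
        (oneFOne 2 (1 / 2) ((Bfun μ Γ C θ q) ^ 2 / Afun Γ C θ q) / (Afun Γ C θ q) ^ 2) := by
    intro θ
    rw [← lintegral_radial_add (Afun_pos hΓ hC hS θ q), mul_add,
      ← lintegral_const_mul _ (by fun_prop), ← lintegral_const_mul _ (by fun_prop)]
    congr 1 <;> refine setLIntegral_congr_fun measurableSet_Ioi fun r hr => ?_
    · simpa using hray θ r hr 1 (by norm_num)
    · simpa [sub_eq_add_neg] using hray θ r hr (-1) (by norm_num)
  have hcont := continuous_quotDensity_integrand hΓ hC hS μ q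
  simp_rw [hθ]
  rw [lintegral_const_mul _ hcont.measurable.ennreal_ofReal, ENNReal.ofReal_mul hk0,
    intervalIntegral.integral_of_le Real.pi_pos.le, integral_Ioc_eq_integral_Ioo,
    ofReal_integral_eq_lintegral_ofReal]
  · exact (hcont.integrableOn_Icc (a := 0) (b := Real.pi)).mono_set Set.Ioo_subset_Icc_self
  · refine .of_forall fun θ => ?_
    have := Afun_pos hΓ hC hS θ q
    exact div_nonneg (oneFOne_nonneg (by positivity)) (by positivity)

/-- **Complex Gaussian quotient density.**
If `f` is the complex Gaussian density with parameters `(μ, Γ, C)`, then the pushforward of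
the measure with density `f` under the (a.e. defined) map `(z₁, z₂) ↦ z₂/z₁` equals the
measure on `ℂ` with density `f_Q`. -/
theorem complex_gaussian_quotient_density
    (μ : Fin 2 → ℂ) (Γ C : Matrix (Fin 2) (Fin 2) ℂ)
    (hΓ : Γ.PosDef) (hC : Cᵀ = C) (hS : (augCov Γ C).PosDef) :
    Measure.map (fun z : Fin 2 → ℂ => z 1 / z 0)
        ((volume : Measure (Fin 2 → ℂ)).withDensity
          (fun z => ENNReal.ofReal (gaussDensity μ (augCov Γ C) z))) =
      (volume : Measure ℂ).withDensity
        (fun q => ENNReal.ofReal (quotDensity μ Γ C q)) := by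
  rw [map_quotient_withDensity (measurable_gaussDensity μ _).ennreal_ofReal]
  simp_rw [lintegral_gaussDensity_smul_qvec hΓ hC hS]

end
end

section
/- Let Γ ∈ Matrix (Fin 2) (Fin 2) ℂ be Hermitian positive definite and let f°(z) := (π² · det Γ)⁻¹ · exp(−zᴴ Γ⁻¹ z) for z ∈ ℂ². Then ∫_{ℂ²} (z₂/z₁) · f°(z) dz = Γ₂₁ / Γ₁₁, where Γ₂₁ is the (2,1) entry and Γ₁₁ the (1,1) entry of Γ (the integral of the ℂ-valued integrand exists by the finiteness of the first absolute moment). That is, the mean of the quotient of the components of a proper, mean-zero bivariate complex Gaussian equals Γ₂₁/Γ₁₁. (Paper's Theorem on quotient moments, part (ii).) -/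
open MeasureTheory Matrix Complex Real
open scoped ComplexOrder

noncomputable section

/-- The proper, mean-zero complex Gaussian density with covariance `Γ`:
`f°(z) = (π²·det Γ)⁻¹ · exp(−zᴴ Γ⁻¹ z)`. -/
def properGaussDensity (Γ : Matrix (Fin 2) (Fin 2) ℂ) (z : Fin 2 → ℂ) : ℝ :=
  (Real.pi ^ 2 * Γ.det.re)⁻¹ * Real.exp (-(star z ⬝ᵥ (Γ⁻¹ *ᵥ z)).re)

/-- The shear `(x, w) ↦ (x, c x + w)` of `ℂ × ℂ`. -/
def complexShear (c : ℂ) : ℂ × ℂ ≃ᵐ ℂ × ℂ where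
  toFun p := (p.1, c * p.1 + p.2)
  invFun p := (p.1, -(c * p.1) + p.2)
  left_inv p := by simp
  right_inv p := by simp
  measurable_toFun := by dsimp; fun_prop
  measurable_invFun := by dsimp; fun_prop

theorem measurePreserving_complexShear (c : ℂ) :
    MeasurePreserving (complexShear c) (volume : Measure (ℂ × ℂ)) volume :=
  (MeasurePreserving.id (volume : Measure ℂ)).skew_product
    (g := fun x w => c * x + w) (by fun_prop)
    (Filter.Eventually.of_forall fun x => map_add_left_eq_self volume (c * x))

/-- The unnormalized isotropic Gaussian on `ℂ`. -/
def isoGauss (b : ℝ) (x : ℂ) : ℂ := (Real.exp (-b * ‖x‖ ^ 2) : ℝ)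

theorem measurable_isoGauss (b : ℝ) : Measurable (isoGauss b) := by
  unfold isoGauss; fun_prop

theorem integral_isoGauss {b : ℝ} (hb : 0 < b) : ∫ x, isoGauss b x = (π / b : ℝ) := by
  have h := Complex.integral_exp_neg_mul_rpow (p := 2) (by norm_num) hb
  have h2 : (-2 / 2 : ℝ) = -1 := by norm_num
  have h3 : (2 / 2 + 1 : ℝ) = 2 := by norm_num
  simp only [Real.rpow_two, h2, h3, Real.rpow_neg_one, Real.Gamma_two, mul_one] at h
  unfold isoGauss
  rw [integral_complex_ofReal, h, div_eq_mul_inv]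

theorem integrable_isoGauss {b : ℝ} (hb : 0 < b) : Integrable (isoGauss b) := by
  apply Integrable.of_integral_ne_zero
  rw [integral_isoGauss hb]
  exact_mod_cast (div_pos Real.pi_pos hb).ne'

theorem integrable_norm_rpow_mul_exp_neg_mul_sq {b q : ℝ} (hb : 0 < b) (hq : -2 < q) :
    Integrable fun x : ℂ => ‖x‖ ^ q * Real.exp (-b * ‖x‖ ^ 2) := by
  have h := Complex.integral_rpow_mul_exp_neg_mul_rpow (p := 2) (by norm_num) hq hb
  simp only [Real.rpow_two] at h
  apply Integrable.of_integral_ne_zero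
  rw [h]
  have : 0 < Real.Gamma ((q + 2) / 2) := Real.Gamma_pos_of_pos (by linarith)
  positivity

theorem integrable_inv_mul_isoGauss {b : ℝ} (hb : 0 < b) :
    Integrable fun x => x⁻¹ * isoGauss b x := by
  refine (integrable_norm_rpow_mul_exp_neg_mul_sq (q := -1) hb (by norm_num)).mono'
    (measurable_inv.mul (measurable_isoGauss b)).aestronglyMeasurable ?_
  refine Filter.Eventually.of_forall fun x => le_of_eq ?_
  rw [norm_mul, norm_inv, isoGauss, Complex.norm_real, Real.norm_of_nonneg (Real.exp_pos _).le,
    Real.rpow_neg_one]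

theorem integrable_mul_isoGauss {b : ℝ} (hb : 0 < b) :
    Integrable fun x => x * isoGauss b x := by
  refine (integrable_norm_rpow_mul_exp_neg_mul_sq (q := 1) hb (by norm_num)).mono'
    (measurable_id.mul (measurable_isoGauss b)).aestronglyMeasurable ?_
  refine Filter.Eventually.of_forall fun x => le_of_eq ?_
  rw [norm_mul, isoGauss, Complex.norm_real, Real.norm_of_nonneg (Real.exp_pos _).le,
    Real.rpow_one]

theorem integral_mul_isoGauss (b : ℝ) : ∫ x, x * isoGauss b x = 0 := by
  have h := integral_neg_eq_self (fun x => x * isoGauss b x) (volume : Measure ℂ)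
  simp only [isoGauss, norm_neg, neg_mul, integral_neg] at h ⊢
  exact self_eq_neg.mp h.symm

theorem integral_quotient_mul_isoGauss {b₁ b₂ : ℝ} (h₁ : 0 < b₁) (h₂ : 0 < b₂) (c : ℂ) :
    ∫ p : ℂ × ℂ, (c * p.1 + p.2) / p.1 * (isoGauss b₁ p.1 * isoGauss b₂ p.2) =
      c * ((π / b₁ : ℝ) * (π / b₂ : ℝ)) := by
  have hne : ∀ᵐ p : ℂ × ℂ, p.1 ≠ 0 :=
    Measure.quasiMeasurePreserving_fst.ae (Measure.ae_ne (volume : Measure ℂ) 0)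
  have hae : (fun p : ℂ × ℂ => (c * p.1 + p.2) / p.1 * (isoGauss b₁ p.1 * isoGauss b₂ p.2))
      =ᵐ[volume] fun p => c * (isoGauss b₁ p.1 * isoGauss b₂ p.2) +
        (p.1⁻¹ * isoGauss b₁ p.1) * (p.2 * isoGauss b₂ p.2) := by
    filter_upwards [hne] with p hp
    field_simp
  rw [integral_congr_ae hae, integral_add, integral_const_mul]
  · rw [Measure.volume_eq_prod, integral_prod_mul (isoGauss b₁) (isoGauss b₂),
      integral_prod_mul (fun x => x⁻¹ * isoGauss b₁ x) (fun x => x * isoGauss b₂ x),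
      integral_mul_isoGauss, integral_isoGauss h₁, integral_isoGauss h₂, mul_zero, add_zero]
  · exact ((integrable_isoGauss h₁).mul_prod (integrable_isoGauss h₂)).const_mul c
  · exact (integrable_inv_mul_isoGauss h₁).mul_prod (integrable_mul_isoGauss h₂)

/-- Completing the square in the exponent of the Gaussian density. -/
theorem properGaussDensity_shear {Γ : Matrix (Fin 2) (Fin 2) ℂ} (hΓ : Γ.PosDef) (x w : ℂ) :
    ((properGaussDensity Γ ![x, Γ 1 0 / Γ 0 0 * x + w] : ℝ) : ℂ) =
      ((π ^ 2 * Γ.det.re)⁻¹ : ℝ) *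
        (isoGauss (Γ 0 0).re⁻¹ x * isoGauss ((Γ 0 0).re / Γ.det.re) w) := by
  have ha := hΓ.diag_pos (i := 0)
  have hD := hΓ.det_pos
  have h01 : Γ 0 1 = star (Γ 1 0) := (hΓ.isHermitian.apply 0 1).symm
  have ha0 := ha.ne'
  have hD0 := hD.ne'
  have har : ((Γ 0 0).re : ℂ) = Γ 0 0 := (Complex.eq_re_of_ofReal_le ha.le).symm
  have hDr : (Γ.det.re : ℂ) = Γ.det := (Complex.eq_re_of_ofReal_le hD.le).symm
  have hsa : star (Γ 0 0) = Γ 0 0 := hΓ.isHermitian.apply 0 0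
  have hdet : Γ.det = Γ 0 0 * Γ 1 1 - star (Γ 1 0) * Γ 1 0 := by rw [det_fin_two, h01]
  have hquad : star ![x, Γ 1 0 / Γ 0 0 * x + w] ⬝ᵥ (Γ⁻¹ *ᵥ ![x, Γ 1 0 / Γ 0 0 * x + w]) =
      (((Γ 0 0).re⁻¹ * ‖x‖ ^ 2 + (Γ 0 0).re / Γ.det.re * ‖w‖ ^ 2 : ℝ) : ℂ) := by
    push_cast
    rw [har, hDr, ← Complex.conj_mul' x, ← Complex.conj_mul' w, Matrix.inv_def,
      Ring.inverse_eq_inv', adjugate_fin_two, h01]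
    simp only [dotProduct, mulVec, Fin.sum_univ_two, Pi.star_apply, Matrix.smul_apply, of_apply,
      cons_val_zero, cons_val_one, smul_eq_mul, star_add, star_mul', star_div₀, hsa,
      starRingEnd_apply]
    have h11 : Γ 1 1 = (Γ.det + star (Γ 1 0) * Γ 1 0) / Γ 0 0 := by
      rw [hdet]; field_simp; ring
    rw [h11]
    field_simp
    ring
  rw [properGaussDensity, hquad, Complex.ofReal_re, isoGauss, isoGauss, ← Complex.ofReal_mul,
    ← Complex.ofReal_mul, ← Real.exp_add]
  congr 3
  ring

/-- **Mean of a proper, mean-zero complex Gaussian quotient.**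
For `Γ` Hermitian positive definite, `∫_{ℂ²} (z₂/z₁)·f°(z) dz = Γ₂₁/Γ₁₁`. -/
theorem proper_gaussian_quotient_mean
    (Γ : Matrix (Fin 2) (Fin 2) ℂ) (hΓ : Γ.PosDef) :
    ∫ z : Fin 2 → ℂ, (z 1 / z 0) * ((properGaussDensity Γ z : ℝ) : ℂ) =
      Γ 1 0 / Γ 0 0 := by
  have ha := hΓ.diag_pos (i := 0)
  have har : 0 < (Γ 0 0).re := (Complex.pos_iff.mp ha).1
  have hDr : 0 < Γ.det.re := (Complex.pos_iff.mp hΓ.det_pos).1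
  rw [← (volume_preserving_finTwoArrow ℂ).symm.integral_comp',
    ← (measurePreserving_complexShear (Γ 1 0 / Γ 0 0)).integral_comp']
  have key : ∀ p : ℂ × ℂ,
      (MeasurableEquiv.finTwoArrow.symm (complexShear (Γ 1 0 / Γ 0 0) p) : Fin 2 → ℂ) =
        ![p.1, Γ 1 0 / Γ 0 0 * p.1 + p.2] := fun p => rfl
  simp only [key, properGaussDensity_shear hΓ, cons_val_zero, cons_val_one,
    mul_left_comm _ (((π ^ 2 * Γ.det.re)⁻¹ : ℝ) : ℂ)]
  rw [integral_const_mul, integral_quotient_mul_isoGauss (inv_pos.mpr har) (div_pos har hDr),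
    mul_left_comm, ← Complex.ofReal_mul, ← Complex.ofReal_mul]
  have : (π ^ 2 * Γ.det.re)⁻¹ * (π / (Γ 0 0).re⁻¹ * (π / ((Γ 0 0).re / Γ.det.re))) = 1 := by
    field_simp
  rw [this, Complex.ofReal_one, mul_one]

end
end

section
/- Let n ≥ 1, let Γ ∈ Matrix (Fin n) (Fin n) ℂ be Hermitian positive definite, let C ∈ Matrix (Fin n) (Fin n) ℂ be symmetric (Cᵀ = C), and suppose that the Schur complement P := conj Γ − (conj C) · Γ⁻¹ · C is positive definite. Set R := (conj C) · Γ⁻¹. Then conj (P⁻¹) · conj R = Γ⁻¹ · C · P⁻¹, and this matrix is symmetric: (conj (P⁻¹) · conj R)ᵀ = conj (P⁻¹) · conj R. (Matrix lemma proven in Section 3 of the paper for the inverse of an augmented covariance matrix.) -/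
open Matrix Complex
open scoped ComplexOrder

/-- Entrywise conjugation of a Hermitian matrix is transposition. -/
theorem Matrix.IsHermitian.map_starRingEnd_eq_transpose {m : Type*} {A : Matrix m m ℂ}
    (hA : A.IsHermitian) : A.map (starRingEnd ℂ) = Aᵀ := by
  ext i j
  exact hA.apply j i

/-- **Symmetry of `conj(P⁻¹)·conj(R)` for the Schur complement of an augmented covariance
matrix.**  Let `Γ` be Hermitian positive definite, `C` symmetric, and suppose the Schur
complement `P = conj Γ − (conj C)·Γ⁻¹·C` is positive definite; set `R = (conj C)·Γ⁻¹`.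
Then `conj(P⁻¹)·conj(R) = Γ⁻¹·C·P⁻¹`, and this matrix is symmetric. -/
theorem schur_complement_conj_inv_mul_symm
    (n : ℕ) (hn : 1 ≤ n) (Γ C : Matrix (Fin n) (Fin n) ℂ)
    (hΓ : Γ.PosDef) (hC : Cᵀ = C)
    (P R : Matrix (Fin n) (Fin n) ℂ)
    (hPdef : P = Γ.map (starRingEnd ℂ) - (C.map (starRingEnd ℂ)) * Γ⁻¹ * C)
    (hP : P.PosDef)
    (hRdef : R = (C.map (starRingEnd ℂ)) * Γ⁻¹) :
    ((P⁻¹).map (starRingEnd ℂ)) * (R.map (starRingEnd ℂ)) = Γ⁻¹ * C * P⁻¹ ∧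
      (((P⁻¹).map (starRingEnd ℂ)) * (R.map (starRingEnd ℂ)))ᵀ =
        ((P⁻¹).map (starRingEnd ℂ)) * (R.map (starRingEnd ℂ)) := by
  have hΓu : IsUnit Γ.det := (isUnit_iff_isUnit_det Γ).mp hΓ.isUnit
  have hPu : IsUnit P.det := (isUnit_iff_isUnit_det P).mp hP.isUnit
  have hΓtu : IsUnit Γᵀ.det := by rwa [det_transpose]
  have hPtu : IsUnit Pᵀ.det := by rwa [det_transpose]
  have hR : R.map (starRingEnd ℂ) = C * Γᵀ⁻¹ := by
    rw [hRdef, Matrix.map_mul, hΓ.isHermitian.inv.map_starRingEnd_eq_transpose,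
      transpose_nonsing_inv]
    congr 1
    ext i j
    simp
  have hCt : (C.map (starRingEnd ℂ))ᵀ = C.map (starRingEnd ℂ) := by
    rw [← transpose_map, hC]
  rw [hΓ.isHermitian.map_starRingEnd_eq_transpose] at hPdef
  have hPt : Pᵀ = Γ - C * Γᵀ⁻¹ * C.map (starRingEnd ℂ) := by
    rw [hPdef, transpose_sub, transpose_transpose, transpose_mul, transpose_mul, hC, hCt,
      transpose_nonsing_inv, Matrix.mul_assoc]
  have key : C * Γᵀ⁻¹ * P = Pᵀ * (Γ⁻¹ * C) := by
    rw [hPt, hPdef, Matrix.mul_sub, Matrix.sub_mul, nonsing_inv_mul_cancel_right _ _ hΓtu,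
      mul_nonsing_inv_cancel_left _ _ hΓu]
    simp only [Matrix.mul_assoc]
  have main : Pᵀ⁻¹ * (C * Γᵀ⁻¹) = Γ⁻¹ * C * P⁻¹ := by
    rw [← mul_nonsing_inv_cancel_right P (C * Γᵀ⁻¹) hPu, key, Matrix.mul_assoc Pᵀ,
      nonsing_inv_mul_cancel_left _ _ hPtu]
  rw [hP.isHermitian.inv.map_starRingEnd_eq_transpose, hR, transpose_nonsing_inv]
  refine ⟨main, ?_⟩
  rw [main, transpose_mul, transpose_mul, hC, transpose_nonsing_inv, transpose_nonsing_inv, main]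
end

section
/- Let h : ℝ → ℂ be a Schwartz function, t ∈ ℝ, and η, η' ∈ ℝ. Then: (a) ∫_ℝ ℱ(h_{t,η})(ξ) · conj(ℱ(h_{t,η'})(ξ)) dξ = γ₀(η' − η); (b) ∫_ℝ ℱ(h_{t,η})(ξ) · conj(ℱ((h')_{t,η'})(ξ)) dξ = −2πi · γ₁(η' − η); (c) ∫_ℝ ℱ((h')_{t,η})(ξ) · conj(ℱ((h')_{t,η'})(ξ)) dξ = 4π² · (γ₂(η' − η) − (η' − η) · γ₁(η' − η)); (d) ∫_ℝ ℱ(h_{t,η})(ξ) · ℱ(h_{t,η'})(−ξ) dξ = ν₀(η + η'); (e) ∫_ℝ ℱ(h_{t,η})(ξ) · ℱ((h')_{t,η'})(−ξ) dξ = 2πi · ((η + η') · ν₀(η + η') − ν₁(η + η')); (f) ∫_ℝ ℱ((h')_{t,η})(ξ) · ℱ((h')_{t,η'})(−ξ) dξ = −4π² · ((η + η') · ν₁(η + η') − ν₂(η + η')). Moreover, if ĥ is real-valued and even then γ₁(0) = 0, so that with η' = η the covariance matrix of the pair is the diagonal matrix diag(γ₀(0), 4π²γ₂(0)). (Content of the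 paper's Lemma on the second-order statistics of the STFT of white noise.) -/
open MeasureTheory Complex Real Matrix

noncomputable section

/-- The Fourier transform `ℱg(ξ) = ∫ g(s)·e^{−2πisξ} ds`. -/
def FT (g : ℝ → ℂ) (ξ : ℝ) : ℂ :=
  ∫ s : ℝ, g s * Complex.exp (-2 * Real.pi * Complex.I * s * ξ)

/-- The modulated and translated window `g_{t,η}(s) = g(s − t)·e^{−2πiη(s − t)}`. -/
def modWin (g : ℝ → ℂ) (t η : ℝ) (s : ℝ) : ℂ :=
  g (s - t) * Complex.exp (-2 * Real.pi * Complex.I * η * (s - t))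

/-- `γ_k(s) = ∫ ξ^k · ĥ(ξ − s) · conj(ĥ(ξ)) dξ`. -/
def gammaK (h : ℝ → ℂ) (k : ℕ) (s : ℝ) : ℂ :=
  ∫ ξ : ℝ, (ξ : ℂ) ^ k * FT h (ξ - s) * (starRingEnd ℂ) (FT h ξ)

/-- `ν_k(s) = ∫ ξ^k · ĥ(ξ) · ĥ(s − ξ) dξ`. -/
def nuK (h : ℝ → ℂ) (k : ℕ) (s : ℝ) : ℂ :=
  ∫ ξ : ℝ, (ξ : ℂ) ^ k * FT h ξ * FT h (s - ξ)

open scoped FourierTransform in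
theorem FT_eq_fourier (g : ℝ → ℂ) : FT g = 𝓕 g := by
  funext ξ
  rw [FT, Real.fourier_eq']
  refine integral_congr_ae (ae_of_all _ fun s => ?_)
  simp only [smul_eq_mul, RCLike.inner_apply, conj_trivial]
  rw [mul_comm]
  congr 2
  push_cast
  ring

/-- Translation by `t` and modulation by `η` act on the Fourier side by a phase and a shift. -/
theorem FT_modWin (g : ℝ → ℂ) (t η ξ : ℝ) :
    FT (modWin g t η) ξ = Complex.exp (-2 * Real.pi * Complex.I * t * ξ) * FT g (ξ + η) := by
  simp only [FT, modWin]
  rw [← integral_const_mul, ← integral_add_right_eq_self _ t]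
  refine integral_congr_ae (ae_of_all _ fun s => ?_)
  simp only [add_sub_cancel_right]
  rw [mul_assoc, mul_left_comm (Complex.exp _), ← Complex.exp_add, ← Complex.exp_add]
  congr 2
  push_cast
  ring

theorem FT_deriv (h : SchwartzMap ℝ ℂ) (ξ : ℝ) :
    FT (deriv (⇑h)) ξ = 2 * Real.pi * Complex.I * ξ * FT (⇑h) ξ := by
  have hd : Integrable (deriv (⇑h)) := (SchwartzMap.derivCLM ℂ ℂ h).integrable
  rw [FT_eq_fourier, FT_eq_fourier, Real.fourier_deriv h.integrable h.differentiable hd]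
  simp

/-- The phases at `ξ` and `-ξ` cancel. -/
theorem phase_mul_phase_neg (t ξ : ℝ) :
    Complex.exp (-2 * Real.pi * Complex.I * t * ξ) *
      Complex.exp (-2 * Real.pi * Complex.I * t * (-ξ : ℝ)) = 1 := by
  rw [← Complex.exp_add, Complex.exp_eq_one_iff]
  exact ⟨0, by push_cast; ring⟩

/-- The phase is unimodular. -/
theorem phase_mul_conj (t ξ : ℝ) :
    Complex.exp (-2 * Real.pi * Complex.I * t * ξ) *
      (starRingEnd ℂ) (Complex.exp (-2 * Real.pi * Complex.I * t * ξ)) = 1 := by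
  rw [← Complex.exp_conj, ← Complex.exp_add, Complex.exp_eq_one_iff]
  refine ⟨0, ?_⟩
  simp only [map_mul, map_neg, Complex.conj_I, Complex.conj_ofReal, map_ofNat]
  push_cast
  ring

theorem integral_FT_modWin_mul_conj (f g : ℝ → ℂ) (t η η' : ℝ) :
    ∫ ξ : ℝ, FT (modWin f t η) ξ * (starRingEnd ℂ) (FT (modWin g t η') ξ) =
      ∫ ξ : ℝ, FT f (ξ - (η' - η)) * (starRingEnd ℂ) (FT g ξ) := by
  rw [← integral_add_right_eq_self
    (fun ξ => FT f (ξ - (η' - η)) * (starRingEnd ℂ) (FT g ξ)) η']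
  refine integral_congr_ae (ae_of_all _ fun ξ => ?_)
  simp only [FT_modWin, map_mul]
  rw [mul_mul_mul_comm, phase_mul_conj, one_mul, show ξ + η' - (η' - η) = ξ + η by ring]

theorem integral_FT_modWin_mul_neg (f g : ℝ → ℂ) (t η η' : ℝ) :
    ∫ ξ : ℝ, FT (modWin f t η) ξ * FT (modWin g t η') (-ξ) =
      ∫ ξ : ℝ, FT f ξ * FT g (η + η' - ξ) := by
  rw [← integral_add_right_eq_self (fun ξ => FT f ξ * FT g (η + η' - ξ)) η]
  refine integral_congr_ae (ae_of_all _ fun ξ => ?_)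
  simp only [FT_modWin]
  rw [mul_mul_mul_comm, phase_mul_phase_neg, one_mul,
    show η + η' - (ξ + η) = -ξ + η' by ring]

open scoped FourierTransform in
theorem exists_schwartzMap_eq_FT (h : SchwartzMap ℝ ℂ) : ∃ F : SchwartzMap ℝ ℂ, FT (⇑h) = F :=
  ⟨𝓕 h, by rw [FT_eq_fourier, SchwartzMap.fourier_coe]⟩

theorem integrable_ofReal_pow_mul_schwartzMap (F : SchwartzMap ℝ ℂ) (k : ℕ) :
    Integrable fun ξ : ℝ => (ξ : ℂ) ^ k * F ξ := by
  refine (F.integrable_pow_mul volume k).mono' (by fun_prop) (ae_of_all _ fun ξ => ?_)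
  simp

theorem exists_norm_schwartzMap_le (F : SchwartzMap ℝ ℂ) : ∃ C : ℝ, ∀ x, ‖F x‖ ≤ C := by
  obtain ⟨C, -, hC⟩ := F.decay 0 0
  exact ⟨C, fun x => by simpa using hC x⟩

theorem integrable_gammaK (h : SchwartzMap ℝ ℂ) (k : ℕ) (s : ℝ) :
    Integrable fun ξ : ℝ => (ξ : ℂ) ^ k * FT (⇑h) (ξ - s) * (starRingEnd ℂ) (FT (⇑h) ξ) := by
  obtain ⟨F, hF⟩ := exists_schwartzMap_eq_FT h
  obtain ⟨C, hC⟩ := exists_norm_schwartzMap_le F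
  rw [hF]
  have hcont : Continuous F := F.continuous
  refine ((integrable_ofReal_pow_mul_schwartzMap F k).norm.const_mul C).mono'
    (by fun_prop) (ae_of_all _ fun ξ => ?_)
  simp only [norm_mul, RCLike.norm_conj]
  rw [mul_comm ‖(ξ : ℂ) ^ k‖, mul_assoc]
  exact mul_le_mul_of_nonneg_right (hC _) (by positivity)

theorem integrable_nuK (h : SchwartzMap ℝ ℂ) (k : ℕ) (s : ℝ) :
    Integrable fun ξ : ℝ => (ξ : ℂ) ^ k * FT (⇑h) ξ * FT (⇑h) (s - ξ) := by
  obtain ⟨F, hF⟩ := exists_schwartzMap_eq_FT h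
  obtain ⟨C, hC⟩ := exists_norm_schwartzMap_le F
  rw [hF]
  have hcont : Continuous F := F.continuous
  refine ((integrable_ofReal_pow_mul_schwartzMap F k).norm.const_mul C).mono'
    (by fun_prop) (ae_of_all _ fun ξ => ?_)
  rw [norm_mul, mul_comm]
  exact mul_le_mul_of_nonneg_right (hC _) (norm_nonneg _)

theorem gammaK_one_zero_of_even (g : ℝ → ℂ) (hg : ∀ ξ, FT g (-ξ) = FT g ξ) :
    gammaK g 1 0 = 0 := by
  have h : gammaK g 1 0 = -gammaK g 1 0 := by
    conv_lhs => rw [gammaK, ← integral_neg_eq_self]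
    rw [gammaK, ← integral_neg]
    refine integral_congr_ae (ae_of_all _ fun ξ => ?_)
    simp [hg]
  exact self_eq_neg.mp h

/-- **Second-order statistics of the STFT of white noise.**
For a Schwartz window `h`, the covariance-type integrals of the Fourier transforms of
`h_{t,η}` and `(h')_{t,η}` are expressed through `γ_k` and `ν_k`; and if `ĥ` is real-valued
and even then `γ₁(0) = 0`, so the covariance matrix at `η' = η` is
`diag(γ₀(0), 4π²γ₂(0))`. -/
theorem stft_noise_second_order_stats
    (h : SchwartzMap ℝ ℂ) (t η η' : ℝ) :
    (∫ ξ : ℝ, FT (modWin (⇑h) t η) ξ * (starRingEnd ℂ) (FT (modWin (⇑h) t η') ξ) =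
        gammaK (⇑h) 0 (η' - η)) ∧
    (∫ ξ : ℝ, FT (modWin (⇑h) t η) ξ * (starRingEnd ℂ) (FT (modWin (deriv (⇑h)) t η') ξ) =
        -2 * Real.pi * Complex.I * gammaK (⇑h) 1 (η' - η)) ∧
    (∫ ξ : ℝ, FT (modWin (deriv (⇑h)) t η) ξ *
          (starRingEnd ℂ) (FT (modWin (deriv (⇑h)) t η') ξ) =
        4 * Real.pi ^ 2 *
          (gammaK (⇑h) 2 (η' - η) - ((η' - η : ℝ) : ℂ) * gammaK (⇑h) 1 (η' - η))) ∧
    (∫ ξ : ℝ, FT (modWin (⇑h) t η) ξ * FT (modWin (⇑h) t η') (-ξ) =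
        nuK (⇑h) 0 (η + η')) ∧
    (∫ ξ : ℝ, FT (modWin (⇑h) t η) ξ * FT (modWin (deriv (⇑h)) t η') (-ξ) =
        2 * Real.pi * Complex.I *
          (((η + η' : ℝ) : ℂ) * nuK (⇑h) 0 (η + η') - nuK (⇑h) 1 (η + η'))) ∧
    (∫ ξ : ℝ, FT (modWin (deriv (⇑h)) t η) ξ * FT (modWin (deriv (⇑h)) t η') (-ξ) =
        -4 * Real.pi ^ 2 *
          (((η + η' : ℝ) : ℂ) * nuK (⇑h) 1 (η + η') - nuK (⇑h) 2 (η + η'))) ∧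
    ((∀ ξ : ℝ, (FT (⇑h) ξ).im = 0) → (∀ ξ : ℝ, FT (⇑h) (-ξ) = FT (⇑h) ξ) →
      gammaK (⇑h) 1 0 = 0 ∧
      !![gammaK (⇑h) 0 0, -2 * Real.pi * Complex.I * gammaK (⇑h) 1 0;
         -2 * Real.pi * Complex.I * (starRingEnd ℂ) (gammaK (⇑h) 1 0),
         4 * Real.pi ^ 2 * gammaK (⇑h) 2 0] =
        Matrix.diagonal ![gammaK (⇑h) 0 0, 4 * Real.pi ^ 2 * gammaK (⇑h) 2 0]) := by
  refine ⟨?_, ?_, ?_, ?_, ?_, ?_, fun _ heven => ?_⟩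
  · rw [integral_FT_modWin_mul_conj]
    simp only [gammaK, pow_zero, one_mul]
  · rw [integral_FT_modWin_mul_conj, gammaK, ← integral_const_mul]
    refine integral_congr_ae (ae_of_all _ fun ξ => ?_)
    simp only [FT_deriv, map_mul, Complex.conj_I, Complex.conj_ofReal, map_ofNat]
    ring
  · rw [integral_FT_modWin_mul_conj, gammaK, gammaK, ← integral_const_mul,
      ← integral_sub (integrable_gammaK h 2 _) ((integrable_gammaK h 1 _).const_mul _),
      ← integral_const_mul]
    refine integral_congr_ae (ae_of_all _ fun ξ => ?_)
    simp only [FT_deriv, map_mul, Complex.conj_I, Complex.conj_ofReal, map_ofNat]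
    push_cast
    linear_combination (-4 * (Real.pi : ℂ) ^ 2 * (ξ - (η' - η)) * ξ *
      FT h (ξ - (η' - η)) * (starRingEnd ℂ) (FT h ξ)) * Complex.I_sq
  · rw [integral_FT_modWin_mul_neg]
    simp only [nuK, pow_zero, one_mul]
  · rw [integral_FT_modWin_mul_neg, nuK, nuK, ← integral_const_mul,
      ← integral_sub ((integrable_nuK h 0 _).const_mul _) (integrable_nuK h 1 _),
      ← integral_const_mul]
    refine integral_congr_ae (ae_of_all _ fun ξ => ?_)
    simp only [FT_deriv]
    push_cast
    ring
  · rw [integral_FT_modWin_mul_neg, nuK, nuK, ← integral_const_mul,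
      ← integral_sub ((integrable_nuK h 1 _).const_mul _) (integrable_nuK h 2 _),
      ← integral_const_mul]
    refine integral_congr_ae (ae_of_all _ fun ξ => ?_)
    simp only [FT_deriv]
    push_cast
    linear_combination (4 * (Real.pi : ℂ) ^ 2 * ξ * (η + η' - ξ) *
      FT h ξ * FT h (η + η' - ξ)) * Complex.I_sq
  · have h0 := gammaK_one_zero_of_even h heven
    refine ⟨h0, ?_⟩
    ext i j
    fin_cases i <;> fin_cases j <;> simp [h0]

end
end

section
/- Let a, b ∈ ℝ with a > b > 0. Then the integral of z ↦ z²/(b·z² + 2a·z + b)² over the unit circle centered at 0, traversed once counterclockwise (Mathlib's circleIntegral with center 0 and radius 1), equals −π·b·i / (2·(a² − b²)^{3/2}). (Contour-integral identity proven by residues in the paper's computation of the mean of a complex Gaussian quotient; note that the denominator b·z² + 2a·z + b is nonvanishing on the unit circle since a/b > 1.) -/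
open Complex Real

/-- The residue theorem at a double pole: if `w` lies inside the unit circle and `s` outside,
the function `z ↦ z ^ 2 / ((z - w) * (z - s)) ^ 2` has circle integral `2πi` times its
residue at `w`. -/
theorem circleIntegral_sq_div_mul_sub_sq {w s : ℂ} (hw : ‖w‖ < 1) (hs : 1 < ‖s‖) :
    (∮ z in C(0, 1), z ^ 2 / ((z - w) * (z - s)) ^ 2) =
      2 * Real.pi * Complex.I * (-(2 * (w * s)) / (w - s) ^ 3) := by
  have hws : w - s ≠ 0 := by
    intro h
    rw [sub_eq_zero.mp h] at hw
    exact lt_asymm hw hs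
  have hderiv : HasDerivAt (fun z : ℂ => z ^ 2 / (z - s) ^ 2) (-(2 * (w * s)) / (w - s) ^ 3) w := by
    have h := ((hasDerivAt_id w).pow 2).div (((hasDerivAt_id w).sub_const s).pow 2)
      (pow_ne_zero 2 hws)
    refine h.congr_deriv ?_
    simp only [id, Pi.pow_apply]
    field_simp
    push_cast
    ring
  have hdiff : DifferentiableOn ℂ (fun z : ℂ => z ^ 2 / (z - s) ^ 2) {s}ᶜ := fun z hz =>
    DifferentiableAt.differentiableWithinAt <| by
      have : (z - s) ^ 2 ≠ 0 := pow_ne_zero 2 (sub_ne_zero.mpr hz)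
      fun_prop (disch := assumption)
  have hball : Metric.closedBall (0 : ℂ) 1 ⊆ {s}ᶜ := by
    rintro z hz rfl
    exact hs.not_ge (mem_closedBall_zero_iff.mp hz)
  have key := two_pi_I_inv_smul_circleIntegral_sub_sq_inv_smul_of_differentiable
    isOpen_compl_singleton hball hdiff (mem_ball_zero_iff.mpr hw)
  rw [hderiv.deriv, inv_smul_eq_iff₀ two_pi_I_ne_zero, smul_eq_mul] at key
  rw [← key]
  congr 1
  funext z
  rw [smul_eq_mul, mul_pow, div_eq_mul_inv, div_eq_mul_inv, mul_inv]
  ring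

/-- **Contour-integral identity for the mean of a complex Gaussian quotient.**
For real `a > b > 0`, the integral of `z ↦ z²/(b·z² + 2a·z + b)²` over the unit circle
(traversed once counterclockwise) equals `−πbi / (2(a² − b²)^{3/2})`. -/
theorem circleIntegral_sq_div_quadratic_sq (a b : ℝ) (hb : 0 < b) (hab : b < a) :
    (∮ z in C(0, 1), z ^ 2 / ((b : ℂ) * z ^ 2 + 2 * (a : ℂ) * z + (b : ℂ)) ^ 2) =
      -((Real.pi : ℂ) * (b : ℂ) * Complex.I) /
        (2 * (((a ^ 2 - b ^ 2) ^ ((3 : ℝ) / 2) : ℝ) : ℂ)) := by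
  have hpos : 0 < a ^ 2 - b ^ 2 := by nlinarith
  set d : ℝ := √(a ^ 2 - b ^ 2) with hd
  have hd0 : 0 < d := Real.sqrt_pos.mpr hpos
  have hdsq : d ^ 2 = a ^ 2 - b ^ 2 := Real.sq_sqrt hpos.le
  have hrpow : (a ^ 2 - b ^ 2) ^ ((3 : ℝ) / 2) = d ^ 3 := by
    rw [hd, Real.sqrt_eq_rpow, ← Real.rpow_mul_natCast hpos.le]
    norm_num
  have hda : d < a := by nlinarith
  have hlt : a - d < b := by nlinarith
  have hw : ‖(((d - a) / b : ℝ) : ℂ)‖ < 1 := by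
    rw [Complex.norm_real, Real.norm_eq_abs, abs_lt, lt_div_iff₀ hb, div_lt_iff₀ hb]
    constructor <;> linarith
  have hs : 1 < ‖((-(a + d) / b : ℝ) : ℂ)‖ := by
    rw [Complex.norm_real, Real.norm_eq_abs, abs_div, abs_neg, abs_of_pos hb,
      abs_of_pos (by linarith), one_lt_div hb]
    linarith
  have hbC : (b : ℂ) ≠ 0 := mod_cast hb.ne'
  have hdC : (d : ℂ) ≠ 0 := mod_cast hd0.ne'
  have hdsqC : (d : ℂ) ^ 2 = (a : ℂ) ^ 2 - (b : ℂ) ^ 2 := mod_cast hdsq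
  have hprod : (((d - a) / b : ℝ) : ℂ) * ((-(a + d) / b : ℝ) : ℂ) = 1 := by
    push_cast
    field_simp
    linear_combination -hdsqC
  have hsub : (((d - a) / b : ℝ) : ℂ) - ((-(a + d) / b : ℝ) : ℂ) = 2 * d / b := by
    push_cast
    ring
  have hsum : (b : ℂ) * ((((d - a) / b : ℝ) : ℂ) + ((-(a + d) / b : ℝ) : ℂ)) = -2 * a := by
    push_cast
    field_simp
    ring
  have hfactor (z : ℂ) : z ^ 2 / ((b : ℂ) * z ^ 2 + 2 * (a : ℂ) * z + (b : ℂ)) ^ 2 =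
      ((b : ℂ) ^ 2)⁻¹ *
        (z ^ 2 / ((z - ((d - a) / b : ℝ)) * (z - (-(a + d) / b : ℝ))) ^ 2) := by
    have hquad : (b : ℂ) * z ^ 2 + 2 * (a : ℂ) * z + (b : ℂ) =
        b * ((z - ((d - a) / b : ℝ)) * (z - (-(a + d) / b : ℝ))) := by
      linear_combination z * hsum - b * hprod
    rw [hquad, mul_pow, div_eq_mul_inv, div_eq_mul_inv, mul_inv]
    ring
  simp_rw [hfactor]
  rw [circleIntegral.integral_const_mul, circleIntegral_sq_div_mul_sub_sq hw hs, hprod, hsub,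
    hrpow]
  push_cast
  field_simp
end

section
/- Let g₁₁, g₂₂ > 0 and g ≥ 0 be real numbers with g² < g₁₁·g₂₂. Then ∫₀^∞ r³ · ((g₁₁ + g₂₂·r²)² − 4g²·r²)^{−3/2} dr = 1 / (4·g₂₂·(g₁₁·g₂₂ − g²)). (Radial integral identity established in the paper's proof that the mean of a proper zero-mean complex Gaussian quotient equals Γ₂₁/Γ₁₁; note that (g₁₁ + g₂₂·r²)² − 4g²·r² > 0 for all r ≥ 0 since 4g²r² < 4g₁₁g₂₂r² ≤ (g₁₁ + g₂₂r²)².) -/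
open Real MeasureTheory

/-- The quadratic `(a + b t)² - 4 c t` is positive on `[0, ∞)` when `c < a b`. -/
lemma quadratic_pos {a b c t : ℝ} (ha : 0 < a) (hc : c < a * b) (ht : 0 ≤ t) :
    0 < (a + b * t) ^ 2 - 4 * c * t := by
  rcases ht.eq_or_lt with rfl | ht
  · simp only [mul_zero, add_zero, sub_zero]; positivity
  · nlinarith [sq_nonneg (a - b * t), mul_pos (sub_pos.2 hc) ht]

lemma linear_add_sqrt_quadratic_pos {a b c t : ℝ} (ha : 0 < a) (hc : c < a * b) (ht : 0 ≤ t) :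
    0 < (2 * a * b - 4 * c) * t + 2 * a ^ 2 +
      2 * a * √((a + b * t) ^ 2 - 4 * c * t) := by
  rcases ht.eq_or_lt with rfl | ht
  · have := sqrt_nonneg ((a + b * 0) ^ 2 - 4 * c * 0)
    simp only [mul_zero, zero_add]; positivity
  · have hct := mul_pos (sub_pos.2 hc) ht
    have h : b * t - a ≤ √((a + b * t) ^ 2 - 4 * c * t) :=
      le_sqrt_of_sq_le (by nlinarith)
    nlinarith [mul_le_mul_of_nonneg_left h ha.le]

/-- A primitive of `t / (2 Q(t)^{3/2})` for `Q(t) = (a + b t)² - 4 c t`, in a form which does not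
degenerate when the discriminant of `Q` vanishes. -/
lemma hasDerivAt_sq_div_sqrt_quadratic {a b c t : ℝ} (ha : 0 < a) (hc : c < a * b)
    (ht : 0 ≤ t) :
    HasDerivAt (fun t : ℝ ↦ t ^ 2 / (√((a + b * t) ^ 2 - 4 * c * t) *
        ((2 * a * b - 4 * c) * t + 2 * a ^ 2 + 2 * a * √((a + b * t) ^ 2 - 4 * c * t))))
      (t / (2 * √((a + b * t) ^ 2 - 4 * c * t) ^ 3)) t := by
  have hQ := quadratic_pos ha hc ht
  have hD := linear_add_sqrt_quadratic_pos ha hc ht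
  have hS := sqrt_pos.2 hQ
  have hSQ := sq_sqrt hQ.le
  have hQ' : HasDerivAt (fun t : ℝ ↦ (a + b * t) ^ 2 - 4 * c * t)
      (2 * (a + b * t) * b - 4 * c) t := by
    have h := ((((hasDerivAt_id' t).const_mul b).const_add a).fun_pow 2).fun_sub
      ((hasDerivAt_id' t).const_mul (4 * c))
    exact h.congr_deriv (by norm_num)
  have hS' := hQ'.sqrt hQ.ne'
  have hD' := (((hasDerivAt_id' t).const_mul (2 * a * b - 4 * c)).add_const (2 * a ^ 2)).fun_add
    (hS'.const_mul (2 * a))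
  refine ((hasDerivAt_pow 2 t).fun_div (hS'.fun_mul hD') (mul_pos hS hD).ne').congr_deriv ?_
  clear hS' hD' hQ'
  generalize √((a + b * t) ^ 2 - 4 * c * t) = S at *
  rw [div_eq_div_iff (by positivity) (by positivity)]
  field_simp
  norm_num only [Nat.cast_ofNat, pow_one]
  linear_combination t * (8 * a * S + 2 * (2 * a * b - 4 * c) * t + 4 * a ^ 2) * hSQ

lemma tendsto_sq_div_sqrt_quadratic {a b c : ℝ} (hb : 0 < b) (hc : c < a * b) :
    Filter.Tendsto (fun t : ℝ ↦ t ^ 2 / (√((a + b * t) ^ 2 - 4 * c * t) *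
        ((2 * a * b - 4 * c) * t + 2 * a ^ 2 + 2 * a * √((a + b * t) ^ 2 - 4 * c * t))))
      Filter.atTop (nhds (1 / (4 * b * (a * b - c)))) := by
  have hcont : ContinuousAt (fun u : ℝ ↦ 1 / (√((a * u + b) ^ 2 - 4 * c * u) *
      ((2 * a * b - 4 * c) + 2 * a ^ 2 * u + 2 * a * √((a * u + b) ^ 2 - 4 * c * u)))) 0 := by
    refine ContinuousAt.div (by fun_prop) (by fun_prop) ?_
    simp only [mul_zero, zero_add, add_zero, sub_zero, sqrt_sq hb.le]
    have := sub_pos.2 hc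
    exact (mul_pos hb (by linarith)).ne'
  have h := hcont.tendsto.comp tendsto_inv_atTop_zero
  simp only [mul_zero, zero_add, add_zero, sub_zero, sqrt_sq hb.le] at h
  convert h.congr' ?_ using 2
  · ring
  · filter_upwards [Filter.eventually_gt_atTop 0] with t ht
    have hsqrt : √((a + b * t) ^ 2 - 4 * c * t) =
        t * √((a * t⁻¹ + b) ^ 2 - 4 * c * t⁻¹) := by
      rw [← sqrt_sq ht.le, ← sqrt_mul (sq_nonneg _), sqrt_sq ht.le]
      congr 1
      field_simp
    simp only [Function.comp_apply, hsqrt]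
    have hfac : t * √((a * t⁻¹ + b) ^ 2 - 4 * c * t⁻¹) * ((2 * a * b - 4 * c) * t + 2 * a ^ 2 +
        2 * a * (t * √((a * t⁻¹ + b) ^ 2 - 4 * c * t⁻¹))) =
        t ^ 2 * (√((a * t⁻¹ + b) ^ 2 - 4 * c * t⁻¹) * ((2 * a * b - 4 * c) + 2 * a ^ 2 * t⁻¹ +
        2 * a * √((a * t⁻¹ + b) ^ 2 - 4 * c * t⁻¹))) := by
      generalize √((a * t⁻¹ + b) ^ 2 - 4 * c * t⁻¹) = S
      field_simp
    rw [hfac, ← div_div (t ^ 2), div_self (pow_pos ht 2).ne']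

lemma rpow_neg_three_halves {x : ℝ} (hx : 0 ≤ x) : x ^ (-(3 : ℝ) / 2) = (√x ^ 3)⁻¹ := by
  rw [sqrt_eq_rpow, ← rpow_natCast, ← rpow_mul hx, ← rpow_neg hx]
  norm_num

/-- **Radial integral identity** from the computation of the mean of a proper zero-mean
complex Gaussian quotient: for reals `g₁₁, g₂₂ > 0` and `g ≥ 0` with `g² < g₁₁·g₂₂`,
`∫₀^∞ r³·((g₁₁ + g₂₂r²)² − 4g²r²)^{−3/2} dr = 1/(4·g₂₂·(g₁₁·g₂₂ − g²))`. -/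
theorem radial_integral_identity (g11 g22 g : ℝ)
    (h11 : 0 < g11) (h22 : 0 < g22) (hg : 0 ≤ g) (hlt : g ^ 2 < g11 * g22) :
    ∫ r in Set.Ioi (0 : ℝ),
        r ^ 3 * ((g11 + g22 * r ^ 2) ^ 2 - 4 * g ^ 2 * r ^ 2) ^ (-(3 : ℝ) / 2) =
      1 / (4 * g22 * (g11 * g22 - g ^ 2)) := by
  have hQ (r : ℝ) : 0 < (g11 + g22 * r ^ 2) ^ 2 - 4 * g ^ 2 * r ^ 2 :=
    quadratic_pos h11 hlt (sq_nonneg r)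
  have h := integral_Ioi_of_hasDerivAt_of_nonneg' (a := 0)
    (g' := fun r ↦ r ^ 3 * ((g11 + g22 * r ^ 2) ^ 2 - 4 * g ^ 2 * r ^ 2) ^ (-(3 : ℝ) / 2))
    (fun r _ ↦ ?_)
    (fun r hr ↦ mul_nonneg (pow_nonneg (le_of_lt hr) 3) (rpow_nonneg (hQ r).le _))
    ((tendsto_sq_div_sqrt_quadratic h22 hlt).comp (Filter.tendsto_pow_atTop two_ne_zero))
  · simpa using h
  · refine (HasDerivAt.comp (h := fun r : ℝ ↦ r ^ 2) r
      (hasDerivAt_sq_div_sqrt_quadratic h11 hlt (sq_nonneg r))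
      (hasDerivAt_pow 2 r)).congr_deriv ?_
    rw [rpow_neg_three_halves (hQ r).le]
    have := sqrt_pos.2 (hQ r)
    field_simp
    norm_num
    ring
end

section
/- Let Γ and C_η be as given and set Σ_η := fromBlocks Γ C_η (conj C_η) (conj Γ) ∈ Matrix (Fin 4) (Fin 4) ℂ, which is Hermitian; denote its real eigenvalues in decreasing order by λ₁(η) ≥ λ₂(η) ≥ λ₃(η) ≥ λ₄(η). Then there exist constants c > 0, C > 0 and η₀ > 0 such that for all 0 < η < η₀: c·η² ≤ λ₃(η) ≤ C·η², c·η⁶ ≤ λ₄(η) ≤ C·η⁶, and c·η⁸ ≤ det Σ_η ≤ C·η⁸ (det Σ_η being a positive real). (Paper's supplementary Lemma on the degeneracy of the augmented covariance matrix of the STFT of white noise in the low-frequency regime η → 0.) -/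
open Matrix Complex Real
open scoped ComplexOrder

noncomputable section

/-- The covariance matrix `Γ = (2√π)⁻¹·!![1, 0; 0, 1/2]`. -/
def Gam : Matrix (Fin 2) (Fin 2) ℂ :=
  ((2 * Real.sqrt Real.pi : ℝ) : ℂ)⁻¹ • !![1, 0; 0, 1 / 2]

/-- The pseudocovariance matrix
`C_η = (e^{−4π²η²}/(2√π))·!![1, 2πiη; 2πiη, 1/2 − 4π²η²]`. -/
def Cmat (η : ℝ) : Matrix (Fin 2) (Fin 2) ℂ :=
  ((Real.exp (-4 * Real.pi ^ 2 * η ^ 2) / (2 * Real.sqrt Real.pi) : ℝ) : ℂ) •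
    !![1, 2 * (Real.pi : ℂ) * Complex.I * (η : ℂ);
       2 * (Real.pi : ℂ) * Complex.I * (η : ℂ),
       1 / 2 - 4 * (Real.pi : ℂ) ^ 2 * (η : ℂ) ^ 2]

/-- The augmented covariance matrix `Σ_η = fromBlocks Γ C_η (conj C_η) (conj Γ)`. -/
def SigMat (η : ℝ) : Matrix (Fin 4) (Fin 4) ℂ :=
  Matrix.reindex finSumFinEquiv finSumFinEquiv
    (Matrix.fromBlocks Gam (Cmat η) ((Cmat η).map (starRingEnd ℂ))
      (Gam.map (starRingEnd ℂ)))

/-- The characteristic polynomial of `SigMat η` at `a * w`, with `a = 1 / (2√π)`,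
`t = 4π²η²` and `g = exp (-t)`, splits into two quadratic factors. -/
lemma det_scalar_sub_sigMat (η a t g w : ℝ) (ha : a = (2 * √π)⁻¹)
    (ht : t = 4 * π ^ 2 * η ^ 2) (hg : g = Real.exp (-t)) :
    (Matrix.scalar (Fin 4) ((a * w : ℝ) : ℂ) - SigMat η).det =
      ((a ^ 4 * ((w ^ 2 - (3 / 2 + g / 2 + g * t) * w + ((1 - g ^ 2) / 2 + g * t)) *
        (w ^ 2 - (3 / 2 - g / 2 - g * t) * w + ((1 - g ^ 2) / 2 - g * t))) : ℝ) : ℂ) := by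
  obtain ⟨u, hu⟩ : ∃ u : ℂ, u = 2 * π * Complex.I * η := ⟨_, rfl⟩
  have hut : (t : ℂ) = -u ^ 2 := by
    rw [hu, ht]; push_cast
    linear_combination (4 * (π : ℂ) ^ 2 * η ^ 2) * Complex.I_sq
  have hut' : 4 * (π : ℂ) ^ 2 * (η : ℂ) ^ 2 = -u ^ 2 := by
    rw [← hut, ht]; push_cast; ring
  have h2 : (starRingEnd ℂ) 2 = 2 := map_ofNat _ 2
  have huc : (starRingEnd ℂ) u = -u := by
    rw [hu]; simp [h2]
  have hGam : Gam = !![(a : ℂ), 0; 0, a / 2] := by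
    ext i j; fin_cases i <;> fin_cases j <;> simp [Gam, ha, div_eq_mul_inv]
  have hscal : Real.exp (-4 * π ^ 2 * η ^ 2) / (2 * √π) = g * a := by
    rw [hg, ha, ht, div_eq_mul_inv]; congr 2; ring
  have hC : Cmat η = !![(g * a : ℂ), g * a * u; g * a * u, g * a * (1 / 2 + u ^ 2)] := by
    rw [Cmat, hscal, hut', ← hu]
    ext i j; fin_cases i <;> fin_cases j <;> simp
  have hS : SigMat η = !![(a : ℂ), 0, g * a, g * a * u;
      0, a / 2, g * a * u, g * a * (1 / 2 + u ^ 2);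
      g * a, -(g * a * u), a, 0;
      -(g * a * u), g * a * (1 / 2 + u ^ 2), 0, a / 2] := by
    rw [SigMat, hC, hGam]
    ext i j
    fin_cases i <;> fin_cases j <;>
      simp [finSumFinEquiv, Fin.addCases, huc, h2, Complex.conj_ofReal]
  have hD : (Matrix.scalar (Fin 4) ((a * w : ℝ) : ℂ) - SigMat η) =
      !![(a * w - a : ℂ), 0, -(g * a), -(g * a * u);
      0, a * w - a / 2, -(g * a * u), -(g * a * (1 / 2 + u ^ 2));
      -(g * a), g * a * u, a * w - a, 0;
      g * a * u, -(g * a * (1 / 2 + u ^ 2)), 0, a * w - a / 2] := by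
    rw [hS]
    ext i j
    fin_cases i <;> fin_cases j <;> simp
  rw [hD]
  push_cast
  rw [hut]
  simp [Matrix.det_succ_row_zero, Fin.sum_univ_succ, Fin.succAbove]
  ring

/-- The eigenvalues of `SigMat η`, rescaled by `2√π`, are the roots of the product of
quadratic factors from `det_scalar_sub_sigMat`. -/
lemma prod_sub_eigenvalues_sigMat (η a t g w : ℝ) (ha : a = (2 * √π)⁻¹)
    (ht : t = 4 * π ^ 2 * η ^ 2) (hg : g = Real.exp (-t)) (hA : (SigMat η).IsHermitian) :
    ∏ i, (a * w - hA.eigenvalues i) =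
      a ^ 4 * ((w ^ 2 - (3 / 2 + g / 2 + g * t) * w + ((1 - g ^ 2) / 2 + g * t)) *
        (w ^ 2 - (3 / 2 - g / 2 - g * t) * w + ((1 - g ^ 2) / 2 - g * t))) := by
  have h := det_scalar_sub_sigMat η a t g w ha ht hg
  rw [← Matrix.eval_charpoly, hA.charpoly_eq, Polynomial.eval_prod] at h
  simp only [Polynomial.eval_sub, Polynomial.eval_X, Polynomial.eval_C] at h
  apply Complex.ofReal_injective
  rw [← h, Complex.ofReal_prod]
  exact Finset.prod_congr rfl fun i _ => Complex.ofReal_sub _ _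

/-- Estimates for the constant coefficients of the two quadratic factors. -/
lemma exp_coeff_bounds {t g : ℝ} (h0 : 0 < t) (h1 : t ≤ 1 / 2) (hg : g = Real.exp (-t)) :
    (1 / 2 ≤ g ∧ g ≤ 1) ∧
    (t ≤ (1 - g ^ 2) / 2 + g * t ∧ (1 - g ^ 2) / 2 + g * t ≤ 3 * t) ∧
    (t ^ 3 / 20 ≤ (1 - g ^ 2) / 2 - g * t ∧ (1 - g ^ 2) / 2 - g * t ≤ t ^ 3) := by
  have hg1 : 1 / 2 ≤ g := by have := Real.add_one_le_exp (-t); linarith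
  have hg2 : g ≤ 1 := by rw [hg]; exact Real.exp_le_one_iff.2 (by linarith)
  have hinv : g * Real.exp t = 1 := by rw [hg, ← Real.exp_add]; simp
  have hp := abs_le.1 (Real.exp_bound (x := t) (by rw [abs_of_pos h0]; linarith)
    (n := 4) (by norm_num))
  have hm := abs_le.1 (Real.exp_bound (x := -t) (by rw [abs_neg, abs_of_pos h0]; linarith)
    (n := 4) (by norm_num))
  rw [← hg] at hm
  simp only [Finset.sum_range_succ, Finset.sum_range_zero, abs_neg, abs_of_pos h0] at hp hm
  norm_num [Nat.factorial] at hp hm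
  obtain ⟨s, hs⟩ : ∃ s, s = (Real.exp t - g) / 2 := ⟨_, rfl⟩
  have hgs : (1 - g ^ 2) / 2 = g * s := by rw [hs, ← hinv]; ring
  have ht3 : 0 < t ^ 3 := by positivity
  have ht4 : t ^ 4 ≤ t ^ 3 / 2 := by nlinarith
  have ht3' : t ^ 3 ≤ t / 4 := by nlinarith [mul_pos h0 h0]
  have hs1 : t ^ 3 / 10 ≤ s - t := by rw [hs]; linarith [hp.1, hm.2]
  have hs2 : s - t ≤ t ^ 3 := by rw [hs]; linarith [hp.2, hm.1]
  rw [hgs]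
  refine ⟨⟨hg1, hg2⟩, ⟨?_, ?_⟩, ?_, ?_⟩ <;> nlinarith

/-- Four ordered reals whose elementary symmetric functions have sizes `1`, `t`, `t ^ 4`
(in degrees two, three and four) have third and fourth members of sizes `t` and `t ^ 3`. -/
lemma root_bounds_of_esymm {m₁ m₂ m₃ m₄ e₁ e₂ e₃ e₄ t : ℝ} (ht : 0 < t)
    (h12 : m₂ ≤ m₁) (h23 : m₃ ≤ m₂) (h34 : m₄ ≤ m₃)
    (hp : ∀ w : ℝ, (w - m₁) * (w - m₂) * (w - m₃) * (w - m₄) =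
      w ^ 4 - e₁ * w ^ 3 + e₂ * w ^ 2 - e₃ * w + e₄)
    (he1 : 0 < e₁) (he2 : 3 / 4 ≤ e₂) (he2' : e₂ ≤ 7) (he3 : t / 2 ≤ e₃) (he3' : e₃ ≤ 6 * t)
    (he4 : t ^ 4 / 20 ≤ e₄) (he4' : e₄ ≤ 3 * t ^ 4) :
    (t / 56 ≤ m₃ ∧ m₃ ≤ 48 * t) ∧ (t ^ 3 / 120 ≤ m₄ ∧ m₄ ≤ 24 * t ^ 3) := by
  have ht4 : 0 < t ^ 4 := by positivity
  have ht3 : 0 < t ^ 3 := by positivity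
  have hpos : 0 < m₄ := by
    by_contra! hle
    have h := hp m₄
    rw [sub_self, mul_zero] at h
    have h1 : 0 ≤ -m₄ := by linarith
    have h2 : 0 ≤ e₁ * (-m₄) ^ 3 := by positivity
    have h3 : 0 ≤ e₃ * (-m₄) := mul_nonneg (by linarith) h1
    have h4 : 0 ≤ e₂ * m₄ ^ 2 := mul_nonneg (by linarith) (sq_nonneg _)
    have h5 : 0 ≤ m₄ ^ 4 := by positivity
    nlinarith
  have hpos3 : 0 < m₃ := by linarith
  have hpos2 : 0 < m₂ := by linarith
  have hpos1 : 0 < m₁ := by linarith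
  have q0 := hp 0
  have q1 := hp 1
  have q2 := hp (-1)
  have q3 := hp 2
  have E4 : e₄ = m₁ * m₂ * m₃ * m₄ := by linarith
  have E2 : e₂ = m₁ * m₂ + m₁ * m₃ + m₁ * m₄ + m₂ * m₃ + m₂ * m₄ + m₃ * m₄ := by
    linarith
  have E3 : e₃ = m₁ * m₂ * m₃ + m₁ * m₂ * m₄ + m₁ * m₃ * m₄ + m₂ * m₃ * m₄ := by
    linarith
  have p13 : m₁ * m₃ ≤ m₁ * m₂ := by gcongr
  have p14 : m₁ * m₄ ≤ m₁ * m₂ := by gcongr; linarith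
  have p23 : m₂ * m₃ ≤ m₁ * m₂ := by nlinarith
  have p24 : m₂ * m₄ ≤ m₁ * m₂ := by nlinarith
  have p34 : m₃ * m₄ ≤ m₁ * m₂ := by nlinarith
  have r1 : m₁ * m₂ * m₄ ≤ m₁ * m₂ * m₃ := by gcongr
  have r2 : m₁ * m₃ * m₄ ≤ m₁ * m₂ * m₃ := by gcongr
  have r3 : m₂ * m₃ * m₄ ≤ m₁ * m₂ * m₃ := by gcongr
  have P : 0 < m₁ * m₂ := by positivity
  have Q : 0 < m₁ * m₂ * m₃ := by positivity
  have s1 : 0 < m₁ * m₃ := by positivity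
  have s2 : 0 < m₁ * m₄ := by positivity
  have s3 : 0 < m₂ * m₃ := by positivity
  have s4 : 0 < m₂ * m₄ := by positivity
  have s5 : 0 < m₃ * m₄ := by positivity
  have s6 : 0 < m₁ * m₂ * m₄ := by positivity
  have s7 : 0 < m₁ * m₃ * m₄ := by positivity
  have s8 : 0 < m₂ * m₃ * m₄ := by positivity
  have P1 : 1 / 8 ≤ m₁ * m₂ := by linarith
  have P2 : m₁ * m₂ ≤ 7 := by linarith
  have Q1 : t / 8 ≤ m₁ * m₂ * m₃ := by linarith
  have Q2 : m₁ * m₂ * m₃ ≤ 6 * t := by linarith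
  refine ⟨⟨?_, ?_⟩, ?_, ?_⟩
  · have : m₁ * m₂ * m₃ ≤ 7 * m₃ := by gcongr
    linarith only [this, Q1]
  · have : 1 / 8 * m₃ ≤ m₁ * m₂ * m₃ := by gcongr
    linarith only [this, Q2]
  · have : m₁ * m₂ * m₃ * m₄ ≤ 6 * t * m₄ := by gcongr
    have : t * (t ^ 3 / 120) ≤ t * m₄ := by linarith only [this, E4, he4]
    exact le_of_mul_le_mul_left this ht
  · have : t / 8 * m₄ ≤ m₁ * m₂ * m₃ * m₄ := by gcongr
    have : t * m₄ ≤ t * (24 * t ^ 3) := by linarith only [this, E4, he4']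
    exact le_of_mul_le_mul_left this ht

/-- **Degeneracy of the augmented covariance matrix in the low-frequency regime.**
Listing the (real) eigenvalues of the Hermitian matrix `Σ_η` in decreasing order as
`λ₁(η) ≥ λ₂(η) ≥ λ₃(η) ≥ λ₄(η)`, there are constants `c, C, η₀ > 0` with, for all
`0 < η < η₀`: `c·η² ≤ λ₃(η) ≤ C·η²`, `c·η⁶ ≤ λ₄(η) ≤ C·η⁶`, and
`c·η⁸ ≤ det Σ_η ≤ C·η⁸` (the determinant being a positive real). -/
theorem augmented_covariance_low_frequency_degeneracy
    (hherm : ∀ η : ℝ, (SigMat η).IsHermitian) :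
    ∃ c > (0 : ℝ), ∃ C > (0 : ℝ), ∃ η₀ > (0 : ℝ), ∀ η : ℝ, 0 < η → η < η₀ →
      ∀ lam : Fin 4 → ℝ,
        (∀ i j : Fin 4, i ≤ j → lam j ≤ lam i) →
        (∃ σ : Equiv.Perm (Fin 4), lam = (hherm η).eigenvalues ∘ σ) →
        (c * η ^ 2 ≤ lam 2 ∧ lam 2 ≤ C * η ^ 2) ∧
        (c * η ^ 6 ≤ lam 3 ∧ lam 3 ≤ C * η ^ 6) ∧
        (c * η ^ 8 ≤ (SigMat η).det.re ∧ (SigMat η).det.re ≤ C * η ^ 8) := by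
  obtain ⟨a, ha⟩ : ∃ a : ℝ, a = (2 * √π)⁻¹ := ⟨_, rfl⟩
  have ha0 : 0 < a := by rw [ha]; positivity
  have ha1 : a ≤ 1 := by
    rw [ha]
    apply inv_le_one_of_one_le₀
    have : 1 ≤ √π := Real.one_le_sqrt.2 (by linarith [Real.pi_gt_three])
    linarith
  refine ⟨a ^ 4 / 120, by positivity, 3 * 40 ^ 4, by norm_num, 1 / 10, by norm_num, ?_⟩
  rintro η hη0 hη1 lam hanti ⟨σ, hσ⟩
  obtain ⟨t, ht⟩ : ∃ t : ℝ, t = 4 * π ^ 2 * η ^ 2 := ⟨_, rfl⟩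
  obtain ⟨g, hg⟩ : ∃ g : ℝ, g = Real.exp (-t) := ⟨_, rfl⟩
  have hπ1 := Real.pi_gt_three
  have hπ2 := Real.pi_lt_d2
  have hη2 : 0 < η ^ 2 := by positivity
  have hπ3 : 9 ≤ π ^ 2 := by nlinarith
  have hπ4 : π ^ 2 ≤ 10 := by nlinarith
  have htl : η ^ 2 ≤ t := by
    rw [ht]; nlinarith
  have htu : t ≤ 40 * η ^ 2 := by
    rw [ht]; gcongr; linarith
  have ht0 : 0 < t := by linarith
  have hth : t ≤ 1 / 2 := by nlinarith
  obtain ⟨⟨hg1, hg2⟩, ⟨hd1, hd1'⟩, hd2, hd2'⟩ := exp_coeff_bounds ht0 hth hg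
  obtain ⟨d₁, hd₁⟩ : ∃ d, d = (1 - g ^ 2) / 2 + g * t := ⟨_, rfl⟩
  obtain ⟨d₂, hd₂⟩ : ∃ d, d = (1 - g ^ 2) / 2 - g * t := ⟨_, rfl⟩
  obtain ⟨s, hs⟩ : ∃ s, s = g / 2 + g * t := ⟨_, rfl⟩
  have hs0 : 0 ≤ s := by rw [hs]; positivity
  have hs1 : s ≤ 1 := by rw [hs]; nlinarith
  have hprod (w : ℝ) : (a * w - lam 0) * (a * w - lam 1) * (a * w - lam 2) * (a * w - lam 3) =
      a ^ 4 * ((w ^ 2 - (3 / 2 + s) * w + d₁) * (w ^ 2 - (3 / 2 - s) * w + d₂)) := by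
    have h := prod_sub_eigenvalues_sigMat η a t g w ha ht hg (hherm η)
    rw [← Equiv.prod_comp σ, Fin.prod_univ_four] at h
    rw [hσ, hd₁, hd₂, hs]
    simp only [Function.comp_apply]
    rw [h]; ring
  rw [← hd₁] at hd1 hd1'
  rw [← hd₂] at hd2 hd2'
  have ht3 : 0 < t ^ 3 := by positivity
  have ht3' : t ^ 3 ≤ t / 4 := by nlinarith [mul_pos ht0 ht0]
  have hd20 : 0 < d₂ := by linarith
  have hd10 : 0 < d₁ := by linarith
  have hdet : (SigMat η).det.re = a ^ 4 * (d₁ * d₂) := by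
    have h := hprod 0
    rw [hσ] at h
    simp only [Function.comp_apply] at h
    rw [(hherm η).det_eq_prod_eigenvalues, ← Equiv.prod_comp σ, Fin.prod_univ_four]
    have h' : ∀ x y z v : ℝ, ((x : ℂ) * y * z * v).re = x * y * z * v := fun x y z v => by
      norm_cast
    refine (h' _ _ _ _).trans ?_
    linear_combination h
  have hlow : t ^ 4 / 20 ≤ d₁ * d₂ := by
    calc t ^ 4 / 20 = t * (t ^ 3 / 20) := by ring
      _ ≤ d₁ * d₂ := by gcongr
  have hupp : d₁ * d₂ ≤ 3 * t ^ 4 := by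
    calc d₁ * d₂ ≤ 3 * t * t ^ 3 := by gcongr
      _ = 3 * t ^ 4 := by ring
  have hs2 : s * d₁ ≤ d₁ := mul_le_of_le_one_left hd10.le hs1
  have hs2' : 0 ≤ s * d₁ := by positivity
  have hs3 : s * d₂ ≤ d₂ := mul_le_of_le_one_left hd20.le hs1
  have hs3' : 0 ≤ s * d₂ := by positivity
  have hss : s ^ 2 ≤ 1 := pow_le_one₀ hs0 hs1
  have hss' : 0 ≤ s ^ 2 := sq_nonneg s
  have hdiv : ∀ i, a * (lam i / a) = lam i := fun i => by field_simp
  obtain ⟨⟨h3, h3'⟩, h4, h4'⟩ := root_bounds_of_esymm (m₁ := lam 0 / a) (m₂ := lam 1 / a)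
    (m₃ := lam 2 / a) (m₄ := lam 3 / a) (e₁ := 3)
    (e₂ := (3 / 2 + s) * (3 / 2 - s) + d₁ + d₂)
    (e₃ := (3 / 2 + s) * d₂ + (3 / 2 - s) * d₁) (e₄ := d₁ * d₂) ht0
    (div_le_div_of_nonneg_right (hanti 0 1 (by decide)) ha0.le)
    (div_le_div_of_nonneg_right (hanti 1 2 (by decide)) ha0.le)
    (div_le_div_of_nonneg_right (hanti 2 3 (by decide)) ha0.le)
    (fun w => by
      have h := hprod w
      rw [← hdiv 0, ← hdiv 1, ← hdiv 2, ← hdiv 3] at h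
      have ha4 : a ^ 4 ≠ 0 := by positivity
      apply mul_left_cancel₀ ha4
      linear_combination h)
    (by norm_num) (by linarith only [hss, hd10, hd20])
    (by linarith only [hss', hd1', hd2', ht3', hth])
    (by linarith only [hs2, hs3', hd20, hd1])
    (by linarith only [hs3, hs2', hd1', hd2', ht3', ht0]) hlow hupp
  rw [le_div_iff₀ ha0] at h3 h4
  rw [div_le_iff₀ ha0] at h3' h4'
  have ha4 : a ^ 4 ≤ a := pow_le_of_le_one ha0.le ha1 (by norm_num)
  have ha4' : a ^ 4 ≤ 1 := ha4.trans ha1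
  have hη3 : η ^ 6 ≤ t ^ 3 := by
    calc η ^ 6 = (η ^ 2) ^ 3 := by ring
      _ ≤ t ^ 3 := by gcongr
  have hη3' : t ^ 3 ≤ 40 ^ 3 * η ^ 6 := by
    calc t ^ 3 ≤ (40 * η ^ 2) ^ 3 := by gcongr
      _ = 40 ^ 3 * η ^ 6 := by ring
  have hη4 : η ^ 8 ≤ t ^ 4 := by
    calc η ^ 8 = (η ^ 2) ^ 4 := by ring
      _ ≤ t ^ 4 := by gcongr
  have hη4' : t ^ 4 ≤ 40 ^ 4 * η ^ 8 := by
    calc t ^ 4 ≤ (40 * η ^ 2) ^ 4 := by gcongr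
      _ = 40 ^ 4 * η ^ 8 := by ring
  rw [hdet]
  refine ⟨⟨?_, ?_⟩, ⟨?_, ?_⟩, ?_, ?_⟩
  · calc a ^ 4 / 120 * η ^ 2 ≤ a / 120 * t := by gcongr
      _ ≤ lam 2 := by linarith only [h3, mul_pos ha0 ht0]
  · calc lam 2 ≤ 48 * t * a := h3'
      _ ≤ 48 * (40 * η ^ 2) * 1 := by gcongr
      _ ≤ 3 * 40 ^ 4 * η ^ 2 := by linarith only [hη2]
  · calc a ^ 4 / 120 * η ^ 6 ≤ a / 120 * t ^ 3 := by gcongr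
      _ ≤ lam 3 := by linarith only [h4]
  · calc lam 3 ≤ 24 * t ^ 3 * a := h4'
      _ ≤ 24 * (40 ^ 3 * η ^ 6) * 1 := by gcongr
      _ ≤ 3 * 40 ^ 4 * η ^ 6 := by linarith only [pow_pos hη0 6]
  · calc a ^ 4 / 120 * η ^ 8 ≤ a ^ 4 / 120 * t ^ 4 := by gcongr
      _ ≤ a ^ 4 * (t ^ 4 / 20) := by linarith only [show 0 < a ^ 4 * t ^ 4 by positivity]
      _ ≤ a ^ 4 * (d₁ * d₂) := by gcongr
  · calc a ^ 4 * (d₁ * d₂) ≤ 1 * (3 * (40 ^ 4 * η ^ 8)) :=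
        mul_le_mul ha4' (by linarith) (by positivity) zero_le_one
      _ = 3 * 40 ^ 4 * η ^ 8 := by ring

end
end
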